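/- The Hanf number of the countable-set-quantifier logic is strictly less than that of second-order logic: h(L^c_{ω,ω}) < h(L^{II}_{ω,ω}). -/

import Mathlib

open FirstOrder Cardinal

namespace Hanf

/-- Formulas of (extensions of) infinitary first-order logic over a vocabulary `L`:
first-order logic with equality, infinitary conjunctions, monadic second-order
(set) variables, binary relation variables, and the quantifiers
`wo` (well-ordering), `∃^c` (countable set), `aa` (stationary), `∃R` (second order),
and `Q^{cf}_{ℵ₀}` (countable cofinality). -/
inductive Fml (L : FirstOrder.Language.{0,0}) : Type 1
  | rel : {n : ℕ} → L.Relations n → (Fin n → L.Term ℕ) → Fml L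
  | eq : L.Term ℕ → L.Term ℕ → Fml L
  | mem : ℕ → L.Term ℕ → Fml L
  | rmem : ℕ → L.Term ℕ → L.Term ℕ → Fml L
  | not : Fml L → Fml L
  | conj : (ι : Type) → (ι → Fml L) → Fml L
  | all : ℕ → Fml L → Fml L
  | qWo : ℕ → ℕ → Fml L → Fml L
  | qC : ℕ → Fml L → Fml L
  | qAA : ℕ → Fml L → Fml L
  | qII : ℕ → Fml L → Fml L
  | qCf : ℕ → ℕ → Fml L → Fml L

variable {L : FirstOrder.Language.{0,0}}

/-- A family of countable subsets of `M` which is closed under unions of countable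
increasing chains and cofinal (under `⊆`) in the countable subsets of `M`. -/
def IsClubFam {M : Type} (C : Set (Set M)) : Prop :=
  (∀ S ∈ C, S.Countable) ∧
  (∀ f : ℕ → Set M, (∀ n, f n ∈ C) → Monotone f → (⋃ n, f n) ∈ C) ∧
  (∀ S : Set M, S.Countable → ∃ T ∈ C, S ⊆ T)

/-- The field of a binary relation. -/
def fieldOf {M : Type} (r : M → M → Prop) : Set M :=
  {a | (∃ b, r a b) ∨ ∃ b, r b a}

/-- `r` well-orders its field. -/
def WellOrdersField {M : Type} (r : M → M → Prop) : Prop :=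
  IsWellOrder (fieldOf r) (fun a b => r a.1 b.1)

/-- `r` is a linear order of its field, of cofinality `ℵ₀`:
it is irreflexive, transitive and trichotomous on its field, some countable
sequence is cofinal in it, and it has no maximal element. -/
def LinearOrdersFieldCofOmega {M : Type} (r : M → M → Prop) : Prop :=
  (∀ a ∈ fieldOf r, ¬ r a a) ∧
  (∀ a ∈ fieldOf r, ∀ b ∈ fieldOf r, ∀ c ∈ fieldOf r, r a b → r b c → r a c) ∧
  (∀ a ∈ fieldOf r, ∀ b ∈ fieldOf r, a ≠ b → r a b ∨ r b a) ∧
  (∃ c : ℕ → M, (∀ n, c n ∈ fieldOf r) ∧ ∀ a ∈ fieldOf r, ∃ n, a = c n ∨ r a (c n)) ∧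
  (∀ a ∈ fieldOf r, ∃ b ∈ fieldOf r, r a b)

/-- Satisfaction, relative to assignments of the first-order variables,
the monadic (set) variables and the binary relation variables. -/
def Eval {M : Type} [L.Structure M] :
    Fml L → (ℕ → M) → (ℕ → Set M) → (ℕ → M → M → Prop) → Prop
  | .rel R ts, va, _, _ => Language.Structure.RelMap R (fun i => (ts i).realize va)
  | .eq t₁ t₂, va, _, _ => t₁.realize va = t₂.realize va
  | .mem X t, va, vs, _ => t.realize va ∈ vs X
  | .rmem R t₁ t₂, va, _, vr => vr R (t₁.realize va) (t₂.realize va)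
  | .not φ, va, vs, vr => ¬ Eval φ va vs vr
  | .conj _ f, va, vs, vr => ∀ i, Eval (f i) va vs vr
  | .all x φ, va, vs, vr => ∀ a, Eval φ (Function.update va x a) vs vr
  | .qWo x y φ, va, vs, vr =>
      WellOrdersField (fun a b =>
        Eval φ (Function.update (Function.update va x a) y b) vs vr)
  | .qC X φ, va, vs, vr => ∃ S : Set M, S.Countable ∧ Eval φ va (Function.update vs X S) vr
  | .qAA X φ, va, vs, vr =>
      ∃ C : Set (Set M), IsClubFam C ∧ ∀ S ∈ C, Eval φ va (Function.update vs X S) vr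
  | .qII R φ, va, vs, vr => ∃ r : M → M → Prop, Eval φ va vs (Function.update vr R r)
  | .qCf x y φ, va, vs, vr =>
      LinearOrdersFieldCofOmega (fun a b =>
        Eval φ (Function.update (Function.update va x a) y b) vs vr)

/-- The variables of a term. -/
def tvars : L.Term ℕ → Set ℕ
  | .var i => {i}
  | .func _ ts => ⋃ i, tvars (ts i)

/-- Free first-order variables. -/
def fv : Fml L → Set ℕ
  | .rel _ ts => ⋃ i, tvars (ts i)
  | .eq t₁ t₂ => tvars t₁ ∪ tvars t₂
  | .mem _ t => tvars t
  | .rmem _ t₁ t₂ => tvars t₁ ∪ tvars t₂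
  | .not φ => fv φ
  | .conj _ f => ⋃ i, fv (f i)
  | .all x φ => fv φ \ {x}
  | .qWo x y φ => fv φ \ {x, y}
  | .qC _ φ => fv φ
  | .qAA _ φ => fv φ
  | .qII _ φ => fv φ
  | .qCf x y φ => fv φ \ {x, y}

/-- Free monadic (set) variables. -/
def sv : Fml L → Set ℕ
  | .rel _ _ => ∅
  | .eq _ _ => ∅
  | .mem X _ => {X}
  | .rmem _ _ _ => ∅
  | .not φ => sv φ
  | .conj _ f => ⋃ i, sv (f i)
  | .all _ φ => sv φ
  | .qWo _ _ φ => sv φ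
  | .qC X φ => sv φ \ {X}
  | .qAA X φ => sv φ \ {X}
  | .qII _ φ => sv φ
  | .qCf _ _ φ => sv φ

/-- Free binary relation variables. -/
def rv : Fml L → Set ℕ
  | .rel _ _ => ∅
  | .eq _ _ => ∅
  | .mem _ _ => ∅
  | .rmem R _ _ => {R}
  | .not φ => rv φ
  | .conj _ f => ⋃ i, rv (f i)
  | .all _ φ => rv φ
  | .qWo _ _ φ => rv φ
  | .qC _ φ => rv φ
  | .qAA _ φ => rv φ
  | .qII R φ => rv φ \ {R}
  | .qCf _ _ φ => rv φ

/-- A sentence: no free variables of any kind. -/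
def IsSentence (φ : Fml L) : Prop := fv φ = ∅ ∧ sv φ = ∅ ∧ rv φ = ∅

/-- Which extra quantifiers a logic allows, and the bound on the size
of its conjunctions (`conjBound = ℵ₀` gives finitary logic). -/
structure Allowed where
  wo : Prop
  c : Prop
  aa : Prop
  ii : Prop
  cf : Prop
  conjBound : Cardinal.{0}

/-- The formula lies in the logic described by `A`. -/
def Ok (A : Allowed) : Fml L → Prop
  | .rel _ _ => True
  | .eq _ _ => True
  | .mem _ _ => True
  | .rmem _ _ _ => True
  | .not φ => Ok A φ
  | .conj ι f => #ι < A.conjBound ∧ ∀ i, Ok A (f i)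
  | .all _ φ => Ok A φ
  | .qWo _ _ φ => A.wo ∧ Ok A φ
  | .qC _ φ => A.c ∧ Ok A φ
  | .qAA _ φ => A.aa ∧ Ok A φ
  | .qII _ φ => A.ii ∧ Ok A φ
  | .qCf _ _ φ => A.cf ∧ Ok A φ

/-- `M ⊨ φ` (for sentences this does not depend on the assignments). -/
def Sat (M : Type) [L.Structure M] (φ : Fml L) : Prop :=
  ∀ (va : ℕ → M) (vs : ℕ → Set M) (vr : ℕ → M → M → Prop), Eval φ va vs vr

/-- `h(φ) < ∞`: `φ` has no models of arbitrarily large cardinality. -/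
def BddSpec (φ : Fml L) : Prop :=
  ∃ κ : Cardinal, ∀ (M : Type) (S : L.Structure M), @Sat L M S φ → #M < κ

/-- The Hanf value `h(φ) = sup {|M|⁺ : M ⊨ φ}`. -/
noncomputable def hanfVal (φ : Fml L) : Cardinal :=
  sSup {c | ∃ (M : Type) (S : L.Structure M), @Sat L M S φ ∧ c = Order.succ #M}

/-- The Hanf number of the logic `A`: the supremum of `h(φ)` over all
sentences `φ` of the logic (in any vocabulary) with `h(φ) < ∞`. -/
noncomputable def hanfNum (A : Allowed) : Cardinal :=
  sSup {c | ∃ (L : FirstOrder.Language.{0,0}) (φ : Fml L),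
    IsSentence φ ∧ Ok A φ ∧ BddSpec φ ∧ c = hanfVal φ}

/-- The Hanf number of the logic `A` computed over vocabularies of cardinality `≤ χ`. -/
noncomputable def hanfNumVocab (A : Allowed) (χ : Cardinal) : Cardinal :=
  sSup {c | ∃ (L : FirstOrder.Language.{0,0}), L.card ≤ χ ∧ ∃ φ : Fml L,
    IsSentence φ ∧ Ok A φ ∧ BddSpec φ ∧ c = hanfVal φ}

/-- `L^{wo}_{ω,ω}`. -/
def Lwo : Allowed := ⟨True, False, False, False, False, ℵ₀⟩
/-- `L^c_{ω,ω}`. -/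
def Lc : Allowed := ⟨False, True, False, False, False, ℵ₀⟩
/-- `L^{aa}_{ω,ω}`. -/
def Laa : Allowed := ⟨False, False, True, False, False, ℵ₀⟩
/-- `L^{II}_{ω,ω}`. -/
def LII : Allowed := ⟨False, False, False, True, False, ℵ₀⟩
/-- `L_{ω,ω}(Q^{cf}_{ℵ₀})`. -/
def Lcf : Allowed := ⟨False, False, False, False, True, ℵ₀⟩
/-- `L^{wo}_{κ,ω}`: conjunctions of `< κ` formulas. -/
def LwoInf (κ : Cardinal) : Allowed := ⟨True, False, False, False, False, κ⟩
/-- `L^c_{κ,ω}`. -/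
def LcInf (κ : Cardinal) : Allowed := ⟨False, True, False, False, False, κ⟩
/-- `L^{II}_{κ,ω}`. -/
def LIIInf (κ : Cardinal) : Allowed := ⟨False, False, False, True, False, κ⟩



set_option linter.unusedVariables false

/-! ### Coincidence lemma for the second-order variables -/

theorem eval_congr {M : Type} [L.Structure M] (φ : Fml L) :
    ∀ (va : ℕ → M) (vs vs' : ℕ → Set M) (vr vr' : ℕ → M → M → Prop),
    (∀ X ∈ sv φ, vs X = vs' X) → (∀ R ∈ rv φ, vr R = vr' R) →
    (Eval φ va vs vr ↔ Eval φ va vs' vr') := by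
  induction φ with
  | rel R ts => intros; simp [Eval]
  | eq t₁ t₂ => intros; simp [Eval]
  | mem X t =>
    intro va vs vs' vr vr' h1 h2
    simp only [Eval]
    rw [h1 X (by simp [sv])]
  | rmem R t₁ t₂ =>
    intro va vs vs' vr vr' h1 h2
    simp only [Eval]
    rw [h2 R (by simp [rv])]
  | not φ ih =>
    intro va vs vs' vr vr' h1 h2
    simp only [Eval]
    rw [ih va vs vs' vr vr' h1 h2]
  | conj ι f ih =>
    intro va vs vs' vr vr' h1 h2
    simp only [Eval]
    refine forall_congr' fun i => ih i va vs vs' vr vr' ?_ ?_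
    · intro X hX; exact h1 X (by simp only [sv, Set.mem_iUnion]; exact ⟨i, hX⟩)
    · intro X hX; exact h2 X (by simp only [rv, Set.mem_iUnion]; exact ⟨i, hX⟩)
  | all x φ ih =>
    intro va vs vs' vr vr' h1 h2
    simp only [Eval]
    exact forall_congr' fun a => ih _ vs vs' vr vr' h1 h2
  | qWo x y φ ih =>
    intro va vs vs' vr vr' h1 h2
    simp only [Eval]
    have : (fun a b => Eval φ (Function.update (Function.update va x a) y b) vs vr) =
        (fun a b => Eval φ (Function.update (Function.update va x a) y b) vs' vr') := by
      funext a b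
      exact propext (ih _ vs vs' vr vr' h1 h2)
    rw [this]
  | qC X φ ih =>
    intro va vs vs' vr vr' h1 h2
    simp only [Eval]
    refine exists_congr fun S => and_congr_right fun _ => ih _ _ _ _ _ ?_ h2
    intro Y hY
    by_cases h : Y = X
    · subst h; simp
    · simp only [Function.update_of_ne h]
      exact h1 Y ⟨hY, h⟩
  | qAA X φ ih =>
    intro va vs vs' vr vr' h1 h2
    simp only [Eval]
    refine exists_congr fun S => and_congr_right fun _ => forall_congr' fun T =>
      imp_congr_right fun _ => ih _ _ _ _ _ ?_ h2
    intro Y hY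
    by_cases h : Y = X
    · subst h; simp
    · simp only [Function.update_of_ne h]
      exact h1 Y ⟨hY, h⟩
  | qII X φ ih =>
    intro va vs vs' vr vr' h1 h2
    simp only [Eval]
    refine exists_congr fun S => ih _ _ _ _ _ h1 ?_
    intro Y hY
    by_cases h : Y = X
    · subst h; simp
    · simp only [Function.update_of_ne h]
      exact h2 Y ⟨hY, h⟩
  | qCf x y φ ih =>
    intro va vs vs' vr vr' h1 h2
    simp only [Eval]
    have : (fun a b => Eval φ (Function.update (Function.update va x a) y b) vs vr) =
        (fun a b => Eval φ (Function.update (Function.update va x a) y b) vs' vr') := by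
      funext a b
      exact propext (ih _ vs vs' vr vr' h1 h2)
    rw [this]

/-! ### Infinitary codes -/

/-- Variables of the infinitary code language. -/
inductive V : Type
  | fo (i : ℕ)
  | d
  | sc (i : ℕ)
  | u (X j : ℕ)
  | v (X j : ℕ)

theorem V_equiv : Nonempty (V ≃ ℕ) := by
  let g : V → ℕ × ℕ × ℕ := fun a => match a with
    | .fo i => (0, i, 0)
    | .d => (1, 0, 0)
    | .sc i => (2, i, 0)
    | .u X j => (3, X, j)
    | .v X j => (4, X, j)
  have hg : Function.Injective g := by
    intro a b h
    cases a <;> cases b <;> simp_all [g]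
  have h1 : Countable V := hg.countable
  have h2 : Infinite V := Infinite.of_injective V.fo (fun a b h => by simpa using h)
  obtain ⟨h⟩ := nonempty_denumerable V
  exact ⟨Denumerable.eqv V⟩

inductive Code (K Ω : Type) : Type
  | atom (k : K) : Code K Ω
  | eqs (a b : V) : Code K Ω
  | rat (o : Ω) (a b : V) : Code K Ω
  | q (W : V → V → Prop) (Wr : Ω → Prop) (C : ℕ → Code K Ω) : Code K Ω

variable {K Ω : Type}

def Code.val {D : Type} (J : K → (V → D) → Prop) :
    Code K Ω → (V → D) → (Ω → D → D → Prop) → Prop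
  | .atom k, x, _ => J k x
  | .eqs a b, x, _ => x a = x b
  | .rat o a b, x, r => r o (x a) (x b)
  | .q W Wr C, x, r => ∀ n y rr, (∀ a b, W a b → y a = x b) → (∀ o, Wr o → rr o = r o) →
      ¬ (C n).val J y rr

/-- Semantic predicates. -/
abbrev SP (K Ω : Type) : Type 1 :=
  ∀ D : Type, (K → (V → D) → Prop) → (V → D) → (Ω → D → D → Prop) → Prop

/-- A semantic predicate is expressible by a code (over nontrivial domains). -/
def Expr (p : SP K Ω) : Prop :=
  ∃ c : Code K Ω, ∀ (D : Type) [Nontrivial D] (J : K → (V → D) → Prop) x r,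
    c.val J x r ↔ p D J x r

theorem Expr.congr {p p' : SP K Ω} (h : Expr p)
    (hh : ∀ (D : Type) [Nontrivial D] (J : K → (V → D) → Prop) x r, p D J x r ↔ p' D J x r) :
    Expr p' := by
  obtain ⟨c, hc⟩ := h
  exact ⟨c, fun D _ J x r => (hc D J x r).trans (hh D J x r)⟩

theorem Expr.atom (k : K) : Expr (Ω := Ω) (fun D J x r => J k x) :=
  ⟨.atom k, fun D _ J x r => Iff.rfl⟩

theorem Expr.eqs (a b : V) : Expr (K := K) (Ω := Ω) (fun D J x r => x a = x b) :=
  ⟨.eqs a b, fun D _ J x r => Iff.rfl⟩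

theorem Expr.rat (o : Ω) (a b : V) : Expr (K := K) (fun D J x r => r o (x a) (x b)) :=
  ⟨.rat o a b, fun D _ J x r => Iff.rfl⟩

theorem Expr.q (W : V → V → Prop) (Wr : Ω → Prop) {p : ℕ → SP K Ω} (h : ∀ n, Expr (p n)) :
    Expr (fun D J x r => ∀ n y r', (∀ a b, W a b → y a = x b) →
      (∀ o, Wr o → r' o = r o) → ¬ p n D J y r') := by
  choose c hc using h
  refine ⟨.q W Wr c, fun D _ J x r => ?_⟩
  simp only [Code.val, hc]

theorem Expr.not {p : SP K Ω} (h : Expr p) : Expr (fun D J x r => ¬ p D J x r) := by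
  refine (Expr.q (fun a b => a = b) (fun _ => True) (fun _ : ℕ => h)).congr ?_
  intro D _ J x r
  constructor
  · intro H
    exact H 0 x r (fun a b h => by rw [h]) (fun _ _ => rfl)
  · intro H n y r' h1 h2
    have e1 : y = x := funext fun a => h1 a a rfl
    have e2 : r' = r := funext fun a => h2 a trivial
    rw [e1, e2]; exact H

theorem Expr.top : Expr (K := K) (Ω := Ω) (fun D J x r => True) :=
  (Expr.eqs V.d V.d).congr fun D _ J x r => by simp

theorem Expr.bot : Expr (K := K) (Ω := Ω) (fun D J x r => False) :=
  (Expr.top).not.congr fun D _ J x r => by simp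

theorem Expr.conj {ι : Type} [Countable ι] {p : ι → SP K Ω} (h : ∀ i, Expr (p i)) :
    Expr (fun D J x r => ∀ i, p i D J x r) := by
  rcases isEmpty_or_nonempty ι with hι | hι
  · exact Expr.top.congr fun D _ J x r => by simp
  · obtain ⟨g, hg⟩ := exists_surjective_nat ι
    refine (Expr.q (fun a b => a = b) (fun _ => True) (fun n : ℕ => (h (g n)).not)).congr ?_
    intro D _ J x r
    constructor
    · intro H i
      obtain ⟨n, rfl⟩ := hg i
      exact not_not.1 (H n x r (fun a b h => by rw [h]) (fun _ _ => rfl))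
    · intro H n y r' h1 h2
      have e1 : y = x := funext fun a => h1 a a rfl
      have e2 : r' = r := funext fun a => h2 a trivial
      rw [e1, e2]; exact not_not.2 (H _)

theorem Expr.and {p p' : SP K Ω} (h : Expr p) (h' : Expr p') :
    Expr (fun D J x r => p D J x r ∧ p' D J x r) := by
  have := Expr.conj (ι := Bool) (p := fun b => if b then p else p')
    (fun b => by cases b <;> simpa)
  exact this.congr fun D _ J x r => by simp [and_comm]

theorem Expr.or {p p' : SP K Ω} (h : Expr p) (h' : Expr p') :
    Expr (fun D J x r => p D J x r ∨ p' D J x r) :=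
  (h.not.and h'.not).not.congr fun D _ J x r => by tauto

theorem Expr.imp {p p' : SP K Ω} (h : Expr p) (h' : Expr p') :
    Expr (fun D J x r => p D J x r → p' D J x r) :=
  (h.not.or h').congr fun D _ J x r => by tauto

theorem Expr.exi {ι : Type} [Countable ι] {p : ι → SP K Ω} (h : ∀ i, Expr (p i)) :
    Expr (fun D J x r => ∃ i, p i D J x r) :=
  (Expr.conj fun i => (h i).not).not.congr fun D _ J x r => by simp

theorem Expr.all (W : V → V → Prop) (Wr : Ω → Prop) {p : SP K Ω} (h : Expr p) :
    Expr (fun D J x r => ∀ y r', (∀ a b, W a b → y a = x b) →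
      (∀ o, Wr o → r' o = r o) → p D J y r') :=
  (Expr.q W Wr (fun _ : ℕ => h.not)).congr fun D _ J x r => by simp

theorem Expr.ex (W : V → V → Prop) (Wr : Ω → Prop) {p : SP K Ω} (h : Expr p) :
    Expr (fun D J x r => ∃ y r', (∀ a b, W a b → y a = x b) ∧
      (∀ o, Wr o → r' o = r o) ∧ p D J y r') :=
  (Expr.all W Wr h.not).not.congr fun D _ J x r => by
    push Not
    rfl

/-! ### Structures from atoms -/

/-- Atoms: the symbols of the vocabulary. -/
abbrev Sy (L : FirstOrder.Language.{0,0}) : Type := (Σ n, L.Relations n) ⊕ (Σ n, L.Functions n)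

def Gr {D : Type} (J : Sy L → (V → D) → Prop) {n : ℕ} (f : L.Functions n) (w : Fin n → D) (y : D) :
    Prop :=
  ∀ x : V → D, x (.sc 0) = y → (∀ i : Fin n, x (.sc (i + 1)) = w i) → J (.inr ⟨n, f⟩) x

open Classical in
@[reducible]
noncomputable def strOf {D : Type} (J : Sy L → (V → D) → Prop) (d : D) : L.Structure D where
  RelMap {n} R w := ∀ x : V → D, (∀ i : Fin n, x (.sc (i + 1)) = w i) → J (.inl ⟨n, R⟩) x
  funMap {n} f w :=
    if h : ∃ y, Gr J f w y ∧ ∀ y', Gr J f w y' → y' = y then h.choose else d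

open Classical in
theorem strOf_fun {D : Type} (J : Sy L → (V → D) → Prop) (d : D) {n : ℕ} (f : L.Functions n)
    (w : Fin n → D) (a : D) : a = (strOf J d).funMap f w ↔
      ((Gr J f w a ∧ ∀ y', Gr J f w y' → y' = a) ∨
        (¬ (∃ y, Gr J f w y ∧ ∀ y', Gr J f w y' → y' = y) ∧ a = d)) := by
  change a = (if h : ∃ y, Gr J f w y ∧ ∀ y', Gr J f w y' → y' = y then h.choose else d) ↔ _
  split_ifs with h
  · have hs := h.choose_spec
    constructor
    · intro e
      left; rw [e]; exact hs
    · rintro (h1 | h1)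
      · exact hs.2 _ h1.1
      · exact absurd h h1.1
  · constructor
    · intro e
      exact Or.inr ⟨h, e⟩
    · rintro (h1 | h1)
      · exact absurd ⟨a, h1⟩ h
      · exact h1.2

/-- The atoms from a structure. -/
def atomsOf {D : Type} (S : L.Structure D) : Sy L → (V → D) → Prop
  | .inl ⟨_, R⟩, x => S.RelMap R (fun i => x (.sc (i + 1)))
  | .inr ⟨_, f⟩, x => x (.sc 0) = S.funMap f (fun i => x (.sc (i + 1)))

theorem exists_asg {D : Type} (n : ℕ) (w : Fin n → D) (y : D) :
    ∃ x : V → D, x (.sc 0) = y ∧ ∀ i : Fin n, x (.sc (i + 1)) = w i := by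
  refine ⟨fun a => match a with
    | .sc (k + 1) => if h : k < n then w ⟨k, h⟩ else y
    | _ => y, rfl, fun i => ?_⟩
  simp

theorem gr_atomsOf {D : Type} (S : L.Structure D) {n : ℕ} (f : L.Functions n)
    (w : Fin n → D) (y : D) : Gr (atomsOf S) f w y ↔ y = S.funMap f w := by
  constructor
  · intro h
    obtain ⟨x, h1, h2⟩ := exists_asg n w y
    have := h x h1 h2
    simp only [atomsOf, h1] at this
    rw [this]
    congr 1
    funext i; exact h2 i
  · intro h x h1 h2
    simp only [atomsOf]
    rw [h1, h]
    congr 1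
    funext i; exact (h2 i).symm

theorem strOf_atomsOf {D : Type} (S : L.Structure D) (d : D) : strOf (atomsOf S) d = S := by
  apply FirstOrder.Language.Structure.ext
  · funext n f w
    symm
    rw [strOf_fun]
    left
    simp only [gr_atomsOf]
    simp
  · funext n R w
    apply propext
    constructor
    · intro h
      obtain ⟨x, h1, h2⟩ := exists_asg n w d
      have := h x h2
      simp only [atomsOf] at this
      have e : (fun i : Fin n => x (.sc (i + 1))) = w := funext h2
      rwa [e] at this
    · intro h x h2
      simp only [atomsOf]
      have e : (fun i : Fin n => x (.sc (i + 1))) = w := funext h2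
      rwa [e]

theorem Expr.gr {n : ℕ} (f : L.Functions n) : Expr (K := Sy L) (Ω := Ω) (fun D J x r =>
    Gr J f (fun i : Fin n => x (.sc (i + 1))) (x (.sc 0))) := by
  refine (Expr.all (fun a b => a = b ∧ (a = .sc 0 ∨ ∃ i : Fin n, a = .sc (i + 1)))
    (fun _ => True) (Expr.atom (.inr ⟨n, f⟩))).congr ?_
  intro D _ J x r
  constructor
  · intro h y h1 h2
    refine h y r ?_ (fun _ _ => rfl)
    rintro a b ⟨rfl, rfl | ⟨i, rfl⟩⟩
    · exact h1
    · exact h2 i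
  · intro h y r' h1 _
    exact h y (h1 _ _ ⟨rfl, Or.inl rfl⟩) (fun i => h1 _ _ ⟨rfl, Or.inr ⟨i, rfl⟩⟩)

theorem Expr.grU {n : ℕ} (f : L.Functions n) : Expr (K := Sy L) (Ω := Ω) (fun D J x r =>
    ∀ y', Gr J f (fun i : Fin n => x (.sc (i + 1))) y' → y' = x (.sc 0)) := by
  refine (Expr.all (fun a b => (a = b ∧ (∃ i : Fin n, a = .sc (i + 1))) ∨
      (a = .fo 0 ∧ b = .sc 0))
    (fun _ => True) ((Expr.gr f).imp (Expr.eqs (.sc 0) (.fo 0)))).congr ?_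
  intro D _ J x r
  constructor
  · intro h y' h1
    have := h (fun a => match a with
      | .sc 0 => y'
      | .fo 0 => x (.sc 0)
      | a => x a) r ?_ (fun _ _ => rfl)
    · exact this h1
    · rintro a b (⟨rfl, ⟨i, rfl⟩⟩ | ⟨rfl, rfl⟩) <;> rfl
  · intro h y r' h1 _ h2
    rw [h1 (.fo 0) (.sc 0) (Or.inr ⟨rfl, rfl⟩)]
    apply h
    have e : (fun i : Fin n => y (.sc (i + 1))) = fun i : Fin n => x (.sc (i + 1)) :=
      funext fun i => h1 _ _ (Or.inl ⟨rfl, i, rfl⟩)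
    rwa [e] at h2

theorem Expr.grE {n : ℕ} (f : L.Functions n) : Expr (K := Sy L) (Ω := Ω) (fun D J x r =>
    ∃ y, Gr J f (fun i : Fin n => x (.sc (i + 1))) y ∧
      ∀ y', Gr J f (fun i : Fin n => x (.sc (i + 1))) y' → y' = y) := by
  refine (Expr.ex (fun a b => (a = b ∧ (∃ i : Fin n, a = .sc (i + 1))))
    (fun _ => True) ((Expr.gr f).and (Expr.grU f))).congr ?_
  intro D _ J x r
  constructor
  · rintro ⟨y, r', h1, _, h2⟩
    have e : (fun i : Fin n => y (.sc (i + 1))) = fun i : Fin n => x (.sc (i + 1)) :=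
      funext fun i => h1 _ _ ⟨rfl, i, rfl⟩
    rw [e] at h2
    exact ⟨_, h2⟩
  · rintro ⟨y, h⟩
    refine ⟨fun a => match a with
      | .sc 0 => y
      | a => x a, r, ?_, fun _ _ => rfl, h⟩
    rintro a b ⟨rfl, ⟨i, rfl⟩⟩
    rfl

theorem Expr.funG {n : ℕ} (f : L.Functions n) : Expr (K := Sy L) (Ω := Ω) (fun D J x r =>
    x (.sc 0) = (strOf J (x .d)).funMap f (fun i : Fin n => x (.sc (i + 1)))) := by
  refine (((Expr.gr f).and (Expr.grU f)).or ((Expr.grE f).not.and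
    (Expr.eqs (.sc 0) .d))).congr ?_
  intro D _ J x r
  rw [strOf_fun]

theorem Expr.relG {n : ℕ} (R : L.Relations n) : Expr (K := Sy L) (Ω := Ω) (fun D J x r =>
    (strOf J (x .d)).RelMap R (fun i : Fin n => x (.sc (i + 1)))) := by
  refine (Expr.all (fun a b => a = b ∧ (∃ i : Fin n, a = .sc (i + 1)))
    (fun _ => True) (Expr.atom (.inl ⟨n, R⟩))).congr ?_
  intro D _ J x r
  constructor
  · intro h y h2
    refine h y r ?_ (fun _ _ => rfl)
    rintro a b ⟨rfl, ⟨i, rfl⟩⟩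
    exact h2 i
  · intro h y r' h1 _
    exact h y (fun i => h1 _ _ ⟨rfl, i, rfl⟩)

/-- Value of a term. -/
noncomputable def tval {D : Type} (J : Sy L → (V → D) → Prop) (x : V → D) (t : L.Term ℕ) : D :=
  letI := strOf J (x .d)
  t.realize (fun i => x (.fo i))

/-- Not a scratch variable. -/
def V.ns : V → Prop
  | .sc _ => False
  | _ => True

theorem tval_congr {D : Type} (J : Sy L → (V → D) → Prop) {x y : V → D}
    (h : ∀ a, a.ns → y a = x a) (t : L.Term ℕ) : tval J y t = tval J x t := by
  have e1 : y .d = x .d := h _ trivial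
  have e2 : (fun i => y (.fo i)) = fun i => x (.fo i) := funext fun i => h _ trivial
  unfold tval
  rw [e1, e2]

/-- Introduce scratch values of finitely many terms. -/
theorem Expr.scr {n : ℕ} (ts : Fin n → L.Term ℕ)
    (hts : ∀ i a, Expr (K := Sy L) (Ω := Ω) (fun D J x r => x a = tval J x (ts i)))
    (a₀ : V) {p : SP (Sy L) Ω} (hp : Expr p) :
    Expr (fun D J x r => ∃ y : V → D, (∀ a, a.ns → y a = x a) ∧ y (.sc 0) = x a₀ ∧
      (∀ i : Fin n, y (.sc (i + 1)) = tval J x (ts i)) ∧ p D J y r) := by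
  refine (Expr.ex (fun a b => (a = b ∧ a.ns) ∨ (a = .sc 0 ∧ b = a₀)) (fun _ => True)
    ((Expr.conj fun i : Fin n => hts i (.sc (i + 1))).and hp)).congr ?_
  intro D _ J x r
  constructor
  · rintro ⟨y, r', h1, h2, h3, h4⟩
    have e2 : r' = r := funext fun a => h2 a trivial
    subst e2
    have hk : ∀ a, a.ns → y a = x a := fun a ha => h1 a a (Or.inl ⟨rfl, ha⟩)
    refine ⟨y, hk, h1 _ _ (Or.inr ⟨rfl, rfl⟩), fun i => ?_, h4⟩
    rw [← tval_congr J hk]; exact h3 i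
  · rintro ⟨y, hk, h0, h3, h4⟩
    refine ⟨y, r, ?_, fun _ _ => rfl, fun i => ?_, h4⟩
    · rintro a b (⟨rfl, ha⟩ | ⟨rfl, rfl⟩)
      · exact hk _ ha
      · exact h0
    · rw [tval_congr J hk]; exact h3 i

theorem exists_scr {D : Type} (x : V → D) (n : ℕ) (w : Fin n → D) (z : D) :
    ∃ y : V → D, (∀ a, a.ns → y a = x a) ∧ y (.sc 0) = z ∧
      (∀ i : Fin n, y (.sc (i + 1)) = w i) := by
  refine ⟨fun a => match a with
    | .sc 0 => z
    | .sc (k + 1) => if h : k < n then w ⟨k, h⟩ else z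
    | a => x a, ?_, rfl, fun i => ?_⟩
  · intro a ha
    cases a <;> simp_all [V.ns]
  · simp

theorem Expr.term (t : L.Term ℕ) : ∀ a : V,
    Expr (K := Sy L) (Ω := Ω) (fun D J x r => x a = tval J x t) := by
  induction t with
  | var i => intro a; exact (Expr.eqs a (.fo i)).congr fun D _ J x r => by simp [tval]
  | func f ts ih =>
    intro a
    refine (Expr.scr ts ih a (Expr.funG f)).congr ?_
    intro D _ J x r
    have key : tval J x (.func f ts) = (strOf J (x .d)).funMap f (fun i => tval J x (ts i)) := rfl
    rw [key]
    constructor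
    · rintro ⟨y, hk, h0, h3, h4⟩
      rw [← h0, h4, hk .d trivial]
      congr 1
      funext i; exact h3 i
    · intro h
      obtain ⟨y, hk, h0, h3⟩ := exists_scr x _ (fun i => tval J x (ts i)) (x a)
      refine ⟨y, hk, h0, h3, ?_⟩
      rw [h0, h, hk .d trivial]
      congr 1
      funext i; exact (h3 i).symm

/-- Set assignment coded by an assignment. -/
def vsOf {D : Type} (x : V → D) (X : ℕ) : Set D :=
  {a | ∃ j, a = x (.u X j) ∧ x (.u X j) = x (.v X j)}

def vrOf {D : Type} {P : Prop} (r : {R : ℕ // P} → D → D → Prop) (R : ℕ) : D → D → Prop :=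
  fun a b => ∃ h : P, r ⟨R, h⟩ a b

def ev {P : Prop} (φ : Fml L) : SP (Sy L) {R : ℕ // P} := fun D J x r =>
  letI := strOf J (x .d)
  Eval φ (fun i => x (.fo i)) (vsOf x) (vrOf r)

theorem Expr.fml (A : Allowed) (hwo : ¬ A.wo) (haa : ¬ A.aa) (hcf : ¬ A.cf)
    (hb : A.conjBound = ℵ₀) (φ : Fml L) : Ok A φ → Expr (ev (P := A.ii) φ) := by
  induction φ with
  | rel R ts =>
    intro _
    refine (Expr.scr ts (fun i => Expr.term (ts i)) .d (Expr.relG R)).congr ?_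
    intro D _ J x r
    have key : ev (.rel R ts) D J x r ↔
      (strOf J (x .d)).RelMap R (fun i => tval J x (ts i)) := Iff.rfl
    rw [key]
    constructor
    · rintro ⟨y, hk, h0, h3, h4⟩
      rw [hk .d trivial] at h4
      have e : (fun i : Fin _ => y (.sc (i + 1))) = fun i => tval J x (ts i) := funext h3
      rwa [e] at h4
    · intro h
      obtain ⟨y, hk, h0, h3⟩ := exists_scr x _ (fun i => tval J x (ts i)) (x .d)
      refine ⟨y, hk, h0, h3, ?_⟩
      rw [hk .d trivial]
      have e : (fun i : Fin _ => y (.sc (i + 1))) = fun i => tval J x (ts i) := funext h3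
      rwa [e]
  | eq t₁ t₂ =>
    intro _
    refine (Expr.scr ![t₁, t₂] (fun i => Expr.term _) .d (Expr.eqs (.sc 1) (.sc 2))).congr ?_
    intro D _ J x r
    have key : ev (.eq t₁ t₂) D J x r ↔ tval J x t₁ = tval J x t₂ := Iff.rfl
    rw [key]
    constructor
    · rintro ⟨y, hk, h0, h3, h4⟩
      have a1 := h3 0
      have a2 := h3 1
      simp at a1 a2
      rw [← a1, ← a2]; exact h4
    · intro h
      obtain ⟨y, hk, h0, h3⟩ := exists_scr x _ (fun i => tval J x (![t₁, t₂] i)) (x .d)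
      refine ⟨y, hk, h0, h3, ?_⟩
      have a1 := h3 0
      have a2 := h3 1
      simp at a1 a2
      rw [a1, a2]; exact h
  | mem X t =>
    intro _
    refine (Expr.scr ![t] (fun i => Expr.term _) .d (Expr.exi fun j : ℕ =>
      (Expr.eqs (.sc 1) (.u X j)).and (Expr.eqs (.u X j) (.v X j)))).congr ?_
    intro D _ J x r
    have key : ev (.mem X t) D J x r ↔ ∃ j, tval J x t = x (.u X j) ∧ x (.u X j) = x (.v X j) :=
      Iff.rfl
    rw [key]
    constructor
    · rintro ⟨y, hk, h0, h3, j, h4, h5⟩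
      have a1 := h3 0
      simp at a1
      rw [a1, hk (.u X j) trivial] at h4
      rw [hk (.u X j) trivial, hk (.v X j) trivial] at h5
      exact ⟨j, h4, h5⟩
    · rintro ⟨j, h4, h5⟩
      obtain ⟨y, hk, h0, h3⟩ := exists_scr x _ (fun i => tval J x (![t] i)) (x .d)
      have a1 := h3 0
      simp at a1
      refine ⟨y, hk, h0, h3, j, ?_, ?_⟩
      · rw [a1, hk (.u X j) trivial]; exact h4
      · rw [hk (.u X j) trivial, hk (.v X j) trivial]; exact h5
  | rmem R t₁ t₂ =>
    intro _
    by_cases hP : A.ii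
    · refine (Expr.scr ![t₁, t₂] (fun i => Expr.term _) .d
        (Expr.rat ⟨R, hP⟩ (.sc 1) (.sc 2))).congr ?_
      intro D _ J x r
      have key : ev (.rmem R t₁ t₂) D J x r ↔ r ⟨R, hP⟩ (tval J x t₁) (tval J x t₂) :=
        ⟨fun ⟨_, h⟩ => h, fun h => ⟨hP, h⟩⟩
      rw [key]
      constructor
      · rintro ⟨y, hk, h0, h3, h4⟩
        have a1 := h3 0
        have a2 := h3 1
        simp at a1 a2
        rw [← a1, ← a2]; exact h4
      · intro h
        obtain ⟨y, hk, h0, h3⟩ := exists_scr x _ (fun i => tval J x (![t₁, t₂] i)) (x .d)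
        refine ⟨y, hk, h0, h3, ?_⟩
        have a1 := h3 0
        have a2 := h3 1
        simp at a1 a2
        rw [a1, a2]; exact h
    · refine Expr.bot.congr ?_
      intro D _ J x r
      refine ⟨False.elim, ?_⟩
      rintro ⟨h, _⟩
      exact hP h
  | not φ ih =>
    intro h
    exact (ih h).not
  | conj ι f ih =>
    rintro ⟨h1, h2⟩
    rw [hb, Cardinal.lt_aleph0_iff_finite] at h1
    have : Countable ι := Finite.to_countable
    exact Expr.conj fun i => ih i (h2 i)
  | all k φ ih =>
    intro h
    refine (Expr.all (fun a b => a = b ∧ a ≠ .fo k) (fun _ => True) (ih h)).congr ?_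
    intro D _ J x r
    have key : ev (.all k φ) D J x r ↔ ∀ a, @Eval L D (strOf J (x .d)) φ
      (Function.update (fun i => x (.fo i)) k a) (vsOf x) (vrOf r) := Iff.rfl
    rw [key]
    constructor
    · intro H a
      have := H (fun b => match b with
        | .fo i => Function.update (fun i => x (.fo i)) k a i
        | b => x b) r ?_ (fun _ _ => rfl)
      · exact this
      · rintro b _ ⟨rfl, hb⟩
        cases b <;> simp_all [Function.update_apply]
    · intro H y r' h1 h2
      have e2 : r' = r := funext fun a => h2 a trivial
      subst e2
      have e1 : (fun i => y (.fo i)) = Function.update (fun i => x (.fo i)) k (y (.fo k)) := by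
        funext i
        by_cases hi : i = k
        · subst hi; simp
        · rw [Function.update_of_ne hi]
          exact h1 _ _ ⟨rfl, by simpa using hi⟩
      have e3 : y .d = x .d := h1 _ _ ⟨rfl, by simp⟩
      have e4 : vsOf y = vsOf x := by
        funext X
        ext a
        simp only [vsOf, Set.mem_ofPred_eq]
        refine exists_congr fun j => ?_
        rw [h1 (.u X j) _ ⟨rfl, by simp⟩, h1 (.v X j) _ ⟨rfl, by simp⟩]
      simp only [ev]
      rw [e1, e3, e4]
      exact H _
  | qWo => exact fun h => absurd h.1 hwo
  | qAA => exact fun h => absurd h.1 haa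
  | qCf => exact fun h => absurd h.1 hcf
  | qC X φ ih =>
    intro h
    refine (Expr.ex (fun a b => a = b ∧ ∀ j, a ≠ .u X j ∧ a ≠ .v X j) (fun _ => True)
      (ih h.2)).congr ?_
    intro D _ J x r
    have key : ev (.qC X φ) D J x r ↔ ∃ S : Set D, S.Countable ∧ @Eval L D (strOf J (x .d)) φ
      (fun i => x (.fo i)) (Function.update (vsOf x) X S) (vrOf r) := Iff.rfl
    rw [key]
    constructor
    · rintro ⟨y, r', h1, h2, h3⟩
      have e2 : r' = r := funext fun a => h2 a trivial
      subst e2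
      refine ⟨vsOf y X, ?_, ?_⟩
      · refine (Set.countable_range (fun j => y (.u X j))).mono ?_
        rintro a ⟨j, rfl, _⟩
        exact ⟨j, rfl⟩
      · have e1 : (fun i => y (.fo i)) = (fun i => x (.fo i)) :=
          funext fun i => h1 _ _ ⟨rfl, by simp⟩
        have e3 : y .d = x .d := h1 _ _ ⟨rfl, by simp⟩
        have e4 : vsOf y = Function.update (vsOf x) X (vsOf y X) := by
          funext Y
          by_cases hY : Y = X
          · subst hY; simp
          · rw [Function.update_of_ne hY]
            ext a
            simp only [vsOf, Set.mem_ofPred_eq]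
            refine exists_congr fun j => ?_
            rw [h1 (.u Y j) _ ⟨rfl, by simp [hY]⟩, h1 (.v Y j) _ ⟨rfl, by simp [hY]⟩]
        rw [← e4, ← e1, ← e3]
        exact h3
    · rintro ⟨S, hS, h3⟩
      have : ∃ f g : ℕ → D, S = {a | ∃ j, a = f j ∧ f j = g j} := by
        rcases S.eq_empty_or_nonempty with h0 | h0
        · obtain ⟨a, b, hab⟩ := exists_pair_ne D
          exact ⟨fun _ => a, fun _ => b, by simp [h0, hab]⟩
        · obtain ⟨f, hf⟩ := hS.exists_eq_range h0
          refine ⟨f, f, ?_⟩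
          ext a
          simp [hf, eq_comm]
      obtain ⟨f, g, hfg⟩ := this
      let y : V → D := fun b => match b with
        | .u Y j => if Y = X then f j else x (.u Y j)
        | .v Y j => if Y = X then g j else x (.v Y j)
        | b => x b
      refine ⟨y, r, ?_, fun _ _ => rfl, ?_⟩
      · rintro b _ ⟨rfl, hb⟩
        cases b with
        | u Y j =>
          have : Y ≠ X := by
            rintro rfl
            exact (hb j).1 rfl
          simp [y, this]
        | v Y j =>
          have : Y ≠ X := by
            rintro rfl
            exact (hb j).2 rfl
          simp [y, this]
        | _ => rfl
      · have e4 : vsOf y = Function.update (vsOf x) X S := by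
          funext Y
          by_cases hY : Y = X
          · subst hY; simp [hfg, vsOf, y]
          · rw [Function.update_of_ne hY]
            simp [vsOf, y, hY]
        simp only [ev]
        rw [e4]
        exact h3
  | qII R φ ih =>
    intro h
    refine (Expr.ex (fun a b => a = b) (fun o => o.1 ≠ R) (ih h.2)).congr ?_
    intro D _ J x r
    have key : ev (.qII R φ) D J x r ↔ ∃ r' : D → D → Prop, @Eval L D (strOf J (x .d)) φ
      (fun i => x (.fo i)) (vsOf x) (Function.update (vrOf r) R r') := Iff.rfl
    rw [key]
    constructor
    · rintro ⟨y, r', h1, h2, h3⟩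
      have e2 : y = x := funext fun a => h1 a a rfl
      subst e2
      refine ⟨vrOf r' R, ?_⟩
      have e4 : vrOf r' = Function.update (vrOf r) R (vrOf r' R) := by
        funext Y
        by_cases hY : Y = R
        · subst hY; simp
        · rw [Function.update_of_ne hY]
          funext a b
          simp only [vrOf]
          refine propext (exists_congr fun hP => ?_)
          rw [h2 ⟨Y, hP⟩ hY]
      rw [← e4]
      exact h3
    · rintro ⟨S, h3⟩
      refine ⟨x, fun o => if o.1 = R then S else r o, by rintro a b rfl; rfl, ?_, ?_⟩
      · intro o ho
        simp [ho]
      · have e4 : vrOf (fun o : {R : ℕ // A.ii} => if o.1 = R then S else r o) =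
            Function.update (vrOf r) R S := by
          funext Y
          by_cases hY : Y = R
          · subst hY
            funext a b
            simp only [Function.update_self]
            exact propext ⟨fun ⟨_, h'⟩ => by simpa using h', fun h' => ⟨h.1, by simpa using h'⟩⟩
          · rw [Function.update_of_ne hY]
            funext a b
            simp only [vrOf, hY, if_false]
        simp only [ev]
        rw [e4]
        exact h3

theorem sentence_code (A : Allowed) (hwo : ¬ A.wo) (haa : ¬ A.aa) (hcf : ¬ A.cf)
    (hb : A.conjBound = ℵ₀) (φ : Fml L) (hs : IsSentence φ) (ho : Ok A φ) :
    ∃ c : Code (Sy L) {R : ℕ // A.ii}, ∀ (D : Type) [Nontrivial D],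
      (∃ S : L.Structure D, @Sat L D S φ) ↔ ∃ J, ∀ x r, c.val (D := D) J x r := by
  obtain ⟨c, hc⟩ := Expr.fml A hwo haa hcf hb φ ho
  refine ⟨c, fun D _ => ⟨?_, ?_⟩⟩
  · rintro ⟨S, hS⟩
    refine ⟨atomsOf S, fun x r => ?_⟩
    rw [hc]
    unfold ev
    rw [strOf_atomsOf]
    exact hS _ _ _
  · rintro ⟨J, hJ⟩
    obtain ⟨d₀, _⟩ := exists_pair_ne D
    refine ⟨strOf J d₀, fun va vs vr => ?_⟩
    let x : V → D := fun b => match b with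
      | .fo i => va i
      | _ => d₀
    have H := (hc D J x (fun o => vr o.1)).1 (hJ _ _)
    refine (@eval_congr L D (strOf J d₀) φ va _ vs _ vr ?_ ?_).1 H
    · simp [hs.2.1]
    · simp [hs.2.2]

/-! ### Data on the natural numbers -/

structure Data (Ω : Type) : Type where
  isQ : ℕ → Prop
  isE : ℕ → Prop
  C : ℕ → ℕ → Prop
  w : ℕ → ℕ → ℕ → Prop
  wr : ℕ → Ω → Prop
  rat : ℕ → Ω → ℕ → ℕ → Prop
  isA : ℕ → Prop

/-- `S` satisfies the Tarski clauses of `d` over `D`. -/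
structure Data.Mod (d : Data Ω) (D : Type)
    (S : ℕ → (ℕ → D) → (Ω → D → D → Prop) → Prop) : Prop where
  hq : ∀ k, d.isQ k → ∀ x r, S k x r ↔ ∀ m, d.C k m → ∀ y r',
    (∀ i j, d.w k i j → y i = x j) → (∀ o, d.wr k o → r' o = r o) → ¬ S m y r'
  he : ∀ k, d.isE k → ∀ x r, S k x r ↔ ∀ i j, d.w k i j → x i = x j
  hr : ∀ k o i j, d.rat k o i j → ∀ x r, S k x r ↔ r o (x i) (x j)
  ha : ∀ k, d.isA k → ∀ x r r', S k x r → S k x r'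

def Data.Has (d : Data Ω) (n : ℕ) (D : Type) : Prop :=
  ∃ S, d.Mod D S ∧ ∀ x r, S n x r

/-- The subcode at an address. -/
def Code.sub : Code K Ω → List ℕ → Code K Ω
  | c, [] => c
  | .q _ _ C, a :: l => (C a).sub l
  | c, _ :: _ => c

theorem Code.sub_append (l : List ℕ) : ∀ (c : Code K Ω) {W Wr C} (a : ℕ),
    c.sub l = .q W Wr C → c.sub (l ++ [a]) = C a := by
  induction l with
  | nil =>
    intro c W Wr C a h
    simp only [Code.sub] at h
    subst h
    simp [Code.sub]
  | cons b l ih =>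
    intro c W Wr C a h
    cases c with
    | q W' Wr' C' =>
      simp only [Code.sub, List.cons_append] at h ⊢
      exact ih _ a h
    | _ => simp [Code.sub] at h

theorem code_data (c : Code K Ω) : ∃ (d : Data Ω) (n : ℕ), ∀ D : Type,
    (∃ J, ∀ x r, c.val (D := D) J x r) ↔ d.Has n D := by
  obtain ⟨e⟩ := V_equiv
  obtain ⟨g₀⟩ := exists_surjective_nat (List ℕ)
  rename_i hg₀
  let g : ℕ → Code K Ω := fun k => c.sub (g₀ k)
  have hroot : c ∈ Set.range g := by
    obtain ⟨k, hk⟩ := hg₀ []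
    exact ⟨k, by simp [g, hk, Code.sub]⟩
  have hcl : ∀ {W Wr C}, Code.q W Wr C ∈ Set.range g → ∀ a, C a ∈ Set.range g := by
    rintro W Wr C ⟨k, hk⟩ a
    obtain ⟨k', hk'⟩ := hg₀ (g₀ k ++ [a])
    refine ⟨k', ?_⟩
    simp only [g, hk']
    exact Code.sub_append _ _ a hk
  have hidx : ∀ c' : Code K Ω, ∃ k, c' ∈ Set.range g → g k = c' := by
    intro c'
    by_cases h : c' ∈ Set.range g
    · obtain ⟨k, hk⟩ := h
      exact ⟨k, fun _ => hk⟩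
    · exact ⟨0, fun h' => absurd h' h⟩
  choose idx hidx using hidx
  let d : Data Ω :=
    { isQ := fun k => ∃ W Wr C, g k = .q W Wr C
      isE := fun k => ∃ a b, g k = .eqs a b
      C := fun k m => ∃ W Wr C a, g k = .q W Wr C ∧ m = idx (C a)
      w := fun k i j => (∃ W Wr C, g k = .q W Wr C ∧ W (e.symm i) (e.symm j)) ∨
        g k = .eqs (e.symm i) (e.symm j)
      wr := fun k o => ∃ W Wr C, g k = .q W Wr C ∧ Wr o
      rat := fun k o i j => g k = .rat o (e.symm i) (e.symm j)
      isA := fun k => ∃ a, g k = .atom a }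
  refine ⟨d, idx c, fun D => ⟨?_, ?_⟩⟩
  · rintro ⟨J, hJ⟩
    refine ⟨fun k x r => (g k).val J (fun a => x (e a)) r, ⟨?_, ?_, ?_, ?_⟩, ?_⟩
    · rintro k ⟨W, Wr, C, hk⟩ x r
      simp only [d]
      rw [hk]
      simp only [Code.val]
      have hm : ∀ a, g (idx (C a)) = C a := fun a => hidx _ (hcl ⟨k, hk⟩ a)
      constructor
      · rintro H m ⟨W', Wr', C', a, h', rfl⟩ y r' h1 h2
        cases h'
        rw [hm]
        apply H a _ r' _ _
        · intro b b' hb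
          exact h1 (e b) (e b') (Or.inl ⟨_, _, _, rfl, by simpa using hb⟩)
        · intro o ho
          exact h2 o ⟨_, _, _, rfl, ho⟩
      · intro H a y r' h1 h2
        have := H (idx (C a)) ⟨_, _, _, a, rfl, rfl⟩ (fun i => y (e.symm i)) r' ?_ ?_
        · rw [hm] at this
          simpa using this
        · rintro i j (⟨W', Wr', C', h', hw⟩ | h')
          · cases h'
            have := h1 _ _ hw
            simpa using this
          · cases h'
        · rintro o ⟨W', Wr', C', h', hw⟩
          cases h'
          exact h2 o hw
    · rintro k ⟨a, b, hk⟩ x r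
      simp only [d]
      rw [hk]
      simp only [Code.val]
      constructor
      · rintro H i j (⟨W', Wr', C', h', hw⟩ | h')
        · cases h'
        · simp only [Code.eqs.injEq] at h'
          rw [h'.1, h'.2] at H
          simpa using H
      · intro H
        exact H _ _ (Or.inr (by simp))
    · intro k o i j hk x r
      simp only [d] at hk
      rw [hk]
      simp [Code.val]
    · rintro k ⟨a, hk⟩ x r r' h
      simp only [hk, Code.val] at h ⊢
      exact h
    · intro x r
      rw [hidx _ hroot]
      exact hJ _ _
  · rintro ⟨S, hS, hn⟩
    let J : K → (V → D) → Prop := fun k x =>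
      ∃ r, S (idx (.atom k)) (fun i => x (e.symm i)) r
    have key : ∀ c' : Code K Ω, c' ∈ Set.range g → ∀ x r,
        S (idx c') x r ↔ c'.val J (fun a => x (e a)) r := by
      intro c'
      induction c' with
      | atom a =>
        intro h x r
        simp only [Code.val, J, Equiv.apply_symm_apply]
        exact ⟨fun h' => ⟨r, h'⟩, fun ⟨r', h'⟩ => hS.ha _ ⟨a, hidx _ h⟩ _ _ _ h'⟩
      | eqs a b =>
        intro h x r
        rw [hS.he _ ⟨a, b, hidx _ h⟩]
        simp only [Code.val, d, hidx _ h]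
        constructor
        · intro H
          exact H (e a) (e b) (Or.inr (by simp))
        · rintro H i j (⟨W', Wr', C', h', hw⟩ | h')
          · cases h'
          · simp only [Code.eqs.injEq] at h'
            rw [h'.1, h'.2] at H
            simpa using H
      | rat o a b =>
        intro h x r
        rw [hS.hr _ o (e a) (e b) (by simp only [d, hidx _ h]; simp)]
        simp [Code.val]
      | q W Wr C ih =>
        intro h x r
        rw [hS.hq _ ⟨_, _, _, hidx _ h⟩]
        simp only [Code.val, d, hidx _ h]
        constructor
        · intro H a y r' h1 h2
          have := H (idx (C a)) ⟨_, _, _, a, rfl, rfl⟩ (fun i => y (e.symm i)) r' ?_ ?_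
          · rw [ih a (hcl h a)] at this
            simpa using this
          · rintro i j (⟨W', Wr', C', h', hw⟩ | h')
            · cases h'
              have := h1 _ _ hw
              simpa using this
            · cases h'
          · rintro o ⟨W', Wr', C', h', hw⟩
            cases h'
            exact h2 o hw
        · rintro H m ⟨W', Wr', C', a, h', rfl⟩ y r' h1 h2
          cases h'
          rw [ih a (hcl h a)]
          apply H a _ r' _ _
          · intro b b' hb
            exact h1 (e b) (e b') (Or.inl ⟨_, _, _, rfl, by simpa using hb⟩)
          · intro o ho
            exact h2 o ⟨_, _, _, rfl, ho⟩
    refine ⟨J, fun x r => ?_⟩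
    have := (key c hroot (fun i => x (e.symm i)) r).1 (hn _ _)
    simpa using this

/-! ### Smallness -/

theorem sentence_data (A : Allowed) (hwo : ¬ A.wo) (haa : ¬ A.aa) (hcf : ¬ A.cf)
    (hb : A.conjBound = ℵ₀) (φ : Fml L) (hs : IsSentence φ) (ho : Ok A φ) :
    ∃ (d : Data {R : ℕ // A.ii}) (n : ℕ), ∀ (D : Type) [Nontrivial D],
      (∃ S : L.Structure D, @Sat L D S φ) ↔ d.Has n D := by
  obtain ⟨c, hc⟩ := sentence_code A hwo haa hcf hb φ hs ho
  obtain ⟨d, n, hd⟩ := code_data c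
  exact ⟨d, n, fun D _ => (hc D).trans (hd D)⟩

theorem hanfVal_bdd (φ : Fml L) (h : BddSpec φ) :
    BddAbove {c | ∃ (M : Type) (S : L.Structure M), @Sat L M S φ ∧ c = Order.succ #M} := by
  obtain ⟨κ, hκ⟩ := h
  refine ⟨κ, ?_⟩
  rintro c ⟨M, S, hM, rfl⟩
  exact Order.succ_le_of_lt (hκ M S hM)

theorem small (A : Allowed) (hwo : ¬ A.wo) (haa : ¬ A.aa) (hcf : ¬ A.cf)
    (hb : A.conjBound = ℵ₀) :
    BddAbove {c | ∃ (L : FirstOrder.Language.{0,0}) (φ : Fml L),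
      IsSentence φ ∧ Ok A φ ∧ BddSpec φ ∧ c = hanfVal φ} := by
  let b : Data {R : ℕ // A.ii} × ℕ → Cardinal.{0} := fun p =>
    sSup {c | ∃ D : Type, Nontrivial D ∧ p.1.Has p.2 D ∧ c = Order.succ #D}
  refine ⟨max 2 (⨆ p, b p), ?_⟩
  rintro c ⟨L, φ, hs, ho, hbd, rfl⟩
  obtain ⟨d, n, hd⟩ := sentence_data A hwo haa hcf hb φ hs ho
  have hbdd : BddAbove {c | ∃ D : Type, Nontrivial D ∧ d.Has n D ∧ c = Order.succ #D} := by
    refine (hanfVal_bdd φ hbd).mono ?_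
    rintro c ⟨D, hD, hh, rfl⟩
    obtain ⟨S, hS⟩ := (hd D).2 hh
    exact ⟨D, S, hS, rfl⟩
  refine csSup_le' ?_
  rintro c ⟨M, S, hM, rfl⟩
  rcases subsingleton_or_nontrivial M with h | h
  · refine le_max_of_le_left ?_
    have h1 : #M ≤ 1 := Cardinal.le_one_iff_subsingleton.2 h
    refine Order.succ_le_of_lt (h1.trans_lt ?_)
    exact Cardinal.one_lt_two
  · refine le_max_of_le_right ?_
    refine le_trans ?_ (le_ciSup (Cardinal.bddAbove_of_small) (d, n))
    exact le_csSup hbdd ⟨M, h, (hd M).1 ⟨S, hM⟩, rfl⟩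

/-! ### The data for the countable-set logic -/

structure Data0 : Type where
  isQ : ℕ → Prop
  isE : ℕ → Prop
  C : ℕ → ℕ → Prop
  w : ℕ → ℕ → ℕ → Prop

structure Data0.Mod (d : Data0) (D : Type) (S : ℕ → (ℕ → D) → Prop) : Prop where
  hq : ∀ k, d.isQ k → ∀ x, S k x ↔ ∀ m, d.C k m → ∀ y,
    (∀ i j, d.w k i j → y i = x j) → ¬ S m y
  he : ∀ k, d.isE k → ∀ x, S k x ↔ ∀ i j, d.w k i j → x i = x j

def Data0.Has (d : Data0) (n : ℕ) (D : Type) : Prop :=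
  ∃ S, d.Mod D S ∧ ∀ x, S n x

theorem sentence_data0 (φ : Fml L) (hs : IsSentence φ) (ho : Ok Lc φ) :
    ∃ (d : Data0) (n : ℕ), ∀ (D : Type) [Nontrivial D],
      (∃ S : L.Structure D, @Sat L D S φ) ↔ d.Has n D := by
  obtain ⟨d, n, hd⟩ := sentence_data Lc (by simp [Lc]) (by simp [Lc]) (by simp [Lc]) rfl φ hs ho
  refine ⟨⟨d.isQ, d.isE, d.C, d.w⟩, n, fun D _ => (hd D).trans ?_⟩
  have hE : IsEmpty {R : ℕ // Lc.ii} := ⟨fun x => x.2⟩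
  constructor
  · rintro ⟨S, hS, hn⟩
    refine ⟨fun k x => S k x hE.elim, ⟨?_, ?_⟩, fun x => hn x _⟩
    · intro k hk x
      rw [hS.hq k hk]
      constructor
      · intro H m hm y hy
        exact H m hm y _ hy (fun o => hE.elim o)
      · intro H m hm y r' hy _
        rw [Subsingleton.elim r' hE.elim]
        exact H m hm y hy
    · intro k hk x
      exact hS.he k hk x _
  · rintro ⟨S, hS, hn⟩
    refine ⟨fun k x _ => S k x, ⟨?_, ?_, ?_, ?_⟩, fun x _ => hn x⟩
    · intro k hk x r
      rw [hS.hq k hk]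
      constructor
      · intro H m hm y _ hy _
        exact H m hm y hy
      · intro H m hm y hy
        exact H m hm y r hy (fun o => hE.elim o)
    · intro k hk x r
      exact hS.he k hk x
    · intro k o
      exact hE.elim o
    · intro k _ x r r' h
      exact h

theorem Data0.Has.congr {d : Data0} {n : ℕ} {D D' : Type} (e : D ≃ D') (h : d.Has n D) :
    d.Has n D' := by
  obtain ⟨S, hS, hn⟩ := h
  refine ⟨fun k x => S k (e.symm ∘ x), ⟨?_, ?_⟩, fun x => hn _⟩
  · intro k hk x
    rw [hS.hq k hk]
    constructor
    · intro H m hm y hy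
      refine H m hm _ fun i j hij => ?_
      simp [hy i j hij]
    · intro H m hm y hy
      have := H m hm (e ∘ y) fun i j hij => ?_
      · simpa [← Function.comp_assoc] using this
      · have := hy i j hij
        simp [this]
  · intro k hk x
    rw [hS.he k hk]
    simp

theorem Data0.Has.skolem {d : Data0} {n : ℕ} {D : Type} (h : d.Has n D) {l κ : Cardinal.{0}}
    (h1 : l ≤ #D) (h2 : l ≤ κ) (h3 : ℵ₀ ≤ κ) (h4 : κ ^ ℵ₀ ≤ κ) :
    ∃ B : Set D, l ≤ #B ∧ #B ≤ κ ∧ d.Has n B := by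
  obtain ⟨S, hS, hn⟩ := h
  obtain ⟨A0, hA0⟩ := Cardinal.le_mk_iff_exists_set.1 h1
  have hw : ∀ k (x : ℕ → D), ∃ y : ℕ → D, d.isQ k → ¬ S k x → ∃ m, d.C k m ∧
      (∀ i j, d.w k i j → y i = x j) ∧ S m y := by
    intro k x
    by_cases hk : d.isQ k ∧ ¬ S k x
    · have := hk.2
      rw [hS.hq k hk.1] at this
      push Not at this
      obtain ⟨m, hm, y, hy, hs⟩ := this
      exact ⟨y, fun _ _ => ⟨m, hm, hy, hs⟩⟩
    · exact ⟨x, fun a b => absurd ⟨a, b⟩ hk⟩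
  choose w hw using hw
  let β : A0 ⊕ (ℕ × ℕ) → Type := fun s => Sum.elim (fun _ => Empty) (fun _ => ℕ) s
  let st : (s : A0 ⊕ (ℕ × ℕ)) → (β s → D) → D := fun s => match s with
    | .inl a => fun _ => a.1
    | .inr p => fun f => w p.1 f p.2
  let ev : WType β → D := fun t => WType.elim D (fun p => st p.1 p.2) t
  have hcard : #(WType β) ≤ κ := by
    refine WType.cardinalMk_le_of_le ?_
    have hs : Cardinal.sum (fun a : A0 ⊕ (ℕ × ℕ) => κ ^ #(β a)) ≤
        Cardinal.sum (fun a : A0 ⊕ (ℕ × ℕ) => κ) := by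
      refine Cardinal.sum_le_sum _ _ ?_
      rintro (a | p)
      · simp only [β, Sum.elim_inl, Cardinal.mk_empty, Cardinal.power_zero]
        exact Cardinal.one_le_aleph0.trans h3
      · simpa only [β, Sum.elim_inr, Cardinal.mk_nat] using h4
    refine hs.trans ?_
    rw [Cardinal.sum_const']
    refine (mul_le_mul_left ?_ _).trans (Cardinal.mul_eq_self h3).le
    simp only [Cardinal.mk_sum, Cardinal.lift_id]
    refine Cardinal.add_le_of_le h3 ?_ ?_
    · rw [hA0]; exact h2
    · exact Cardinal.mk_le_aleph0.trans h3
  have hcl : ∀ k (x : ℕ → Set.range ev) i, w k (fun j => (x j).1) i ∈ Set.range ev := by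
    intro k x i
    choose t ht using fun j => (x j).2
    refine ⟨WType.mk (.inr (k, i)) t, ?_⟩
    simp only [ev, WType.elim, st]
    congr 1
    funext j
    exact ht j
  have hA : A0 ⊆ Set.range ev := by
    intro a ha
    exact ⟨WType.mk (.inl ⟨a, ha⟩) (fun e => e.elim), rfl⟩
  refine ⟨Set.range ev, ?_, Cardinal.mk_range_le.trans hcard, ?_⟩
  · rw [← hA0]
    exact Cardinal.mk_le_mk_of_subset hA
  · refine ⟨fun k x => S k (fun j => (x j).1), ⟨?_, ?_⟩, fun x => hn _⟩
    · intro k hk x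
      constructor
      · intro H m hm y hy
        rw [hS.hq k hk] at H
        exact H m hm _ fun i j hij => congrArg _ (hy i j hij)
      · intro H
        by_contra hcon
        obtain ⟨m, hm, hy, hs⟩ := hw k _ hk hcon
        exact H m hm (fun i => ⟨w k (fun j => (x j).1) i, hcl k x i⟩)
          (fun i j hij => Subtype.ext (hy i j hij)) hs
    · intro k hk x
      rw [hS.he k hk]
      simp [Subtype.ext_iff]

set_option linter.unusedSimpArgs false
/-! ### Formula combinators -/

def fand (a b : Fml L) : Fml L := .conj Bool (fun i => cond i a b)
def fOr (a b : Fml L) : Fml L := .not (fand (.not a) (.not b))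
def fimp (a b : Fml L) : Fml L := .not (fand a (.not b))
def fiff (a b : Fml L) : Fml L := fand (fimp a b) (fimp b a)
def fex (x : ℕ) (a : Fml L) : Fml L := .not (.all x (.not a))
def fallR (x : ℕ) (a : Fml L) : Fml L := .not (.qII x (.not a))

section
variable {M : Type} [L.Structure M] (va : ℕ → M) (vs : ℕ → Set M) (vr : ℕ → M → M → Prop)

theorem eval_and (a b : Fml L) : Eval (fand a b) va vs vr ↔
    (Eval a va vs vr ∧ Eval b va vs vr) := by
  simp only [fand, Eval, Bool.forall_bool]
  simp only [cond]
  tauto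

theorem eval_not (a : Fml L) : Eval (.not a) va vs vr ↔ ¬ Eval a va vs vr := Iff.rfl

theorem eval_or (a b : Fml L) : Eval (fOr a b) va vs vr ↔
    (Eval a va vs vr ∨ Eval b va vs vr) := by
  simp only [fOr, eval_and, eval_not]
  tauto

theorem eval_imp (a b : Fml L) : Eval (fimp a b) va vs vr ↔
    (Eval a va vs vr → Eval b va vs vr) := by
  simp only [fimp, eval_and, eval_not]
  tauto

theorem eval_iff (a b : Fml L) : Eval (fiff a b) va vs vr ↔
    (Eval a va vs vr ↔ Eval b va vs vr) := by
  simp only [fiff, eval_and, eval_imp]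
  tauto

theorem eval_all (x : ℕ) (a : Fml L) : Eval (.all x a) va vs vr ↔
    ∀ m, Eval a (Function.update va x m) vs vr := Iff.rfl

theorem eval_ex (x : ℕ) (a : Fml L) : Eval (fex x a) va vs vr ↔
    ∃ m, Eval a (Function.update va x m) vs vr := by
  simp [fex, eval_not, eval_all]

theorem eval_exR (x : ℕ) (a : Fml L) : Eval (.qII x a) va vs vr ↔
    ∃ r, Eval a va vs (Function.update vr x r) := Iff.rfl

theorem eval_allR (x : ℕ) (a : Fml L) : Eval (fallR x a) va vs vr ↔
    ∀ r, Eval a va vs (Function.update vr x r) := by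
  simp [fallR, eval_not, eval_exR]

theorem eval_eq (a b : L.Term ℕ) : Eval (.eq a b) va vs vr ↔ a.realize va = b.realize va := Iff.rfl

theorem eval_rmem (i : ℕ) (a b : L.Term ℕ) : Eval (.rmem i a b) va vs vr ↔
    vr i (a.realize va) (b.realize va) := Iff.rfl

end

/-- Boundedness of a formula: variables below `n`, no set variables, in `L^{II}`. -/
def Bd (n : ℕ) (φ : Fml L) : Prop :=
  (∀ x ∈ fv φ, x < n) ∧ sv φ = ∅ ∧ (∀ x ∈ rv φ, x < n) ∧ Ok LII φ

section
variable {n : ℕ} {a b : Fml L}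

theorem Bd.not (h : Bd n a) : Bd n (.not a) := h

theorem Bd.conj (h : Bd n a) (h' : Bd n b) : Bd n (fand a b) := by
  refine ⟨?_, ?_, ?_, ?_⟩
  · intro x hx
    simp only [fand, fv, Set.mem_iUnion] at hx
    obtain ⟨i, hi⟩ := hx
    cases i
    · exact h'.1 x hi
    · exact h.1 x hi
  · simp only [fand, sv, Set.iUnion_eq_empty]
    intro i
    cases i
    · exact h'.2.1
    · exact h.2.1
  · intro x hx
    simp only [fand, rv, Set.mem_iUnion] at hx
    obtain ⟨i, hi⟩ := hx
    cases i
    · exact h'.2.2.1 x hi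
    · exact h.2.2.1 x hi
  · refine ⟨?_, ?_⟩
    · exact Cardinal.lt_aleph0_of_finite Bool
    · intro i
      cases i
      · exact h'.2.2.2
      · exact h.2.2.2

theorem Bd.or (h : Bd n a) (h' : Bd n b) : Bd n (fOr a b) := (h.not.conj h'.not).not
theorem Bd.imp (h : Bd n a) (h' : Bd n b) : Bd n (fimp a b) := (h.conj h'.not).not
theorem Bd.iff (h : Bd n a) (h' : Bd n b) : Bd n (fiff a b) := (h.imp h').conj (h'.imp h)
theorem Bd.all (x : ℕ) (h : Bd n a) : Bd n (.all x a) :=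
  ⟨fun y hy => h.1 y hy.1, h.2.1, h.2.2.1, h.2.2.2⟩
theorem Bd.ex (x : ℕ) (h : Bd n a) : Bd n (fex x a) := (h.not.all x).not
theorem Bd.exR (x : ℕ) (h : Bd n a) : Bd n (.qII x a) :=
  ⟨h.1, h.2.1, fun y hy => h.2.2.1 y hy.1, trivial, h.2.2.2⟩
theorem Bd.allR (x : ℕ) (h : Bd n a) : Bd n (fallR x a) := (h.not.exR x).not

/-- Terms with variables below `n`. -/
def TB (n : ℕ) (t : L.Term ℕ) : Prop := ∀ x ∈ tvars t, x < n

theorem Bd.eq {t t' : L.Term ℕ} (h : TB n t) (h' : TB n t') : Bd n (.eq t t') :=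
  ⟨fun x hx => hx.elim (h x) (h' x), rfl, fun x hx => hx.elim, trivial⟩

theorem Bd.rmem {t t' : L.Term ℕ} {R : ℕ} (hR : R < n) (h : TB n t) (h' : TB n t') :
    Bd n (.rmem R t t') :=
  ⟨fun x hx => hx.elim (h x) (h' x), rfl, fun x hx => by simp [rv] at hx; omega, trivial⟩

theorem Bd.rel {m : ℕ} {R : L.Relations m} {ts : Fin m → L.Term ℕ} (h : ∀ i, TB n (ts i)) :
    Bd n (.rel R ts) :=
  ⟨fun x hx => by
    simp only [fv, Set.mem_iUnion] at hx
    obtain ⟨i, hi⟩ := hx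
    exact h i x hi, rfl, fun x hx => hx.elim, trivial⟩

theorem TB.var {i : ℕ} (h : i < n) : TB n (Language.Term.var i : L.Term ℕ) := by
  intro x hx
  simp [tvars] at hx
  omega

theorem TB.func {m : ℕ} {f : L.Functions m} {ts : Fin m → L.Term ℕ} (h : ∀ i, TB n (ts i)) :
    TB n (Language.Term.func f ts) := by
  intro x hx
  simp only [tvars, Set.mem_iUnion] at hx
  obtain ⟨i, hi⟩ := hx
  exact h i x hi

/-- Universal closure below `n`. -/
def close (φ : Fml L) : ℕ → Fml L
  | 0 => φ
  | n + 1 => .all n (fallR n (close φ n))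

theorem fv_fallR (x : ℕ) : fv (fallR x a) = fv a := rfl
theorem sv_fallR (x : ℕ) : sv (fallR x a) = sv a := rfl
theorem rv_fallR (x : ℕ) : rv (fallR x a) = rv a \ {x} := rfl

theorem close_spec (φ : Fml L) (n : ℕ) : fv (close φ n) = fv φ \ {x | x < n} ∧
    sv (close φ n) = sv φ ∧ rv (close φ n) = rv φ \ {x | x < n} ∧
    (Ok LII φ → Ok LII (close φ n)) := by
  induction n with
  | zero => simp [close]
  | succ n ih =>
    obtain ⟨h1, h2, h3, h4⟩ := ih
    simp only [close, fv, sv, rv, fv_fallR, sv_fallR, rv_fallR, h1, h2, h3, true_and]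
    refine ⟨?_, ?_, fun h => ⟨trivial, h4 h⟩⟩
    · ext x; simp; grind
    · ext x; simp; grind

theorem close_sentence (h : Bd n a) : IsSentence (close a n) ∧ Ok LII (close a n) := by
  obtain ⟨h1, h2, h3, h4⟩ := close_spec a n
  refine ⟨⟨?_, ?_, ?_⟩, h4 h.2.2.2⟩
  · rw [h1, Set.sdiff_eq_empty]; exact h.1
  · rw [h2, h.2.1]
  · rw [h3, Set.sdiff_eq_empty]; exact h.2.2.1

theorem close_eval {M : Type} [L.Structure M] (p : Prop)
    (h : ∀ (va : ℕ → M) vs vr, Eval a va vs vr ↔ p) : ∀ n (va : ℕ → M) vs vr,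
    Eval (close a n) va vs vr ↔ p := by
  intro n
  induction n with
  | zero => exact h
  | succ n ih =>
    intro va vs vr
    simp only [close, eval_all, eval_allR, ih]
    have : Nonempty M := ⟨va 0⟩
    simp

end

/-! ### The vocabulary -/

inductive F0 : ℕ → Type
  | z : F0 0
  | s : F0 1
  | app : F0 2

inductive R0 : ℕ → Type
  | P : R0 1
  | N : R0 1
  | G : R0 2

def L0 : FirstOrder.Language.{0,0} := ⟨F0, R0⟩

structure Str (M : Type) where
  z : M
  s : M → M
  app : M → M → M
  P : M → Prop
  N : M → Prop
  G : M → M → Prop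

def toStr {M : Type} (S : L0.Structure M) : Str M where
  z := S.funMap (n := 0) F0.z ![]
  s a := S.funMap (n := 1) F0.s ![a]
  app a b := S.funMap (n := 2) F0.app ![a, b]
  P a := S.RelMap (n := 1) R0.P ![a]
  N a := S.RelMap (n := 1) R0.N ![a]
  G a b := S.RelMap (n := 2) R0.G ![a, b]

@[reducible]
def ofStr {M : Type} (T : Str M) : L0.Structure M where
  funMap {n} f := match n, f with
    | _, F0.z => fun _ => T.z
    | _, F0.s => fun v => T.s (v 0)
    | _, F0.app => fun v => T.app (v 0) (v 1)
  RelMap {n} f := match n, f with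
    | _, R0.P => fun v => T.P (v 0)
    | _, R0.N => fun v => T.N (v 0)
    | _, R0.G => fun v => T.G (v 0) (v 1)

theorem toStr_ofStr {M : Type} (T : Str M) : toStr (ofStr T) = T := rfl

abbrev tv (i : ℕ) : L0.Term ℕ := .var i
def tz : L0.Term ℕ := .func (l := 0) (show L0.Functions 0 from F0.z) ![]
def ts (t : L0.Term ℕ) : L0.Term ℕ := .func (l := 1) (show L0.Functions 1 from F0.s) ![t]
def ta (t u : L0.Term ℕ) : L0.Term ℕ := .func (l := 2) (show L0.Functions 2 from F0.app) ![t, u]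
def fP (t : L0.Term ℕ) : Fml L0 := .rel (n := 1) (show L0.Relations 1 from R0.P) ![t]
def fN (t : L0.Term ℕ) : Fml L0 := .rel (n := 1) (show L0.Relations 1 from R0.N) ![t]
def fG (t u : L0.Term ℕ) : Fml L0 := .rel (n := 2) (show L0.Relations 2 from R0.G) ![t, u]
def fR (i : ℕ) (t : L0.Term ℕ) : Fml L0 := .rmem i t t

section
variable {M : Type} [S : L0.Structure M] (va : ℕ → M) (vs : ℕ → Set M) (vr : ℕ → M → M → Prop)
variable (t u : L0.Term ℕ)

theorem vec1 : (fun i => (![t] i).realize va) = ![t.realize va] := by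
  funext i; fin_cases i; rfl
theorem vec2 : (fun i => (![t, u] i).realize va) = ![t.realize va, u.realize va] := by
  funext i; fin_cases i <;> rfl
theorem re_v (i : ℕ) : (tv i).realize va = va i := rfl
theorem re_z : tz.realize va = (toStr S).z := by
  simp only [tz, Language.Term.realize, toStr]
  congr 1
  exact Subsingleton.elim _ _
theorem re_s : (ts t).realize va = (toStr S).s (t.realize va) := by
  simp only [ts, Language.Term.realize, toStr, vec1]
theorem re_a : (ta t u).realize va = (toStr S).app (t.realize va) (u.realize va) := by
  simp only [ta, Language.Term.realize, toStr, vec2]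
theorem ev_P : Eval (fP t) va vs vr ↔ (toStr S).P (t.realize va) := by
  simp only [fP, Eval, toStr, vec1]
theorem ev_N : Eval (fN t) va vs vr ↔ (toStr S).N (t.realize va) := by
  simp only [fN, Eval, toStr, vec1]
theorem ev_G : Eval (fG t u) va vs vr ↔ (toStr S).G (t.realize va) (u.realize va) := by
  simp only [fG, Eval, toStr, vec2]
theorem ev_R (i : ℕ) : Eval (fR i t) va vs vr ↔ vr i (t.realize va) (t.realize va) := Iff.rfl
end

section
variable {n : ℕ} {t u : L0.Term ℕ}
theorem TB.z : TB n tz := TB.func (fun i => i.elim0)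
theorem TB.s (h : TB n t) : TB n (ts t) := TB.func (fun i => by fin_cases i; exact h)
theorem TB.a (h : TB n t) (h' : TB n u) : TB n (ta t u) :=
  TB.func (fun i => by fin_cases i; exacts [h, h'])
theorem Bd.P (h : TB n t) : Bd n (fP t) := Bd.rel (fun i => by fin_cases i; exact h)
theorem Bd.N (h : TB n t) : Bd n (fN t) := Bd.rel (fun i => by fin_cases i; exact h)
theorem Bd.G (h : TB n t) (h' : TB n u) : Bd n (fG t u) :=
  Bd.rel (fun i => by fin_cases i; exacts [h, h'])
theorem Bd.R {i : ℕ} (hi : i < n) (h : TB n t) : Bd n (fR i t) := Bd.rmem hi h h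
end

/-! ### The sentence -/

def InjP {M : Type} (A B : M → Prop) : Prop :=
  ∃ f : M → M → Prop, (∀ a, A a → ∃ b, B b ∧ f a b) ∧
    ∀ a, A a → ∀ a', A a' → ∀ b, f a b → f a' b → a = a'

def Str.Seq {M : Type} (T : Str M) (D : M → Prop) (x : M) : Prop := ∀ i, T.N i → D (T.app x i)

def Str.Mod {M : Type} (T : Str M) (c w q e n : M) (D : M → Prop) : Prop :=
  ∃ S : M → M → Prop,
    (∀ k, T.N k → T.app q k = T.z → ∀ x, T.Seq D x → (S k x ↔
      ∀ m, T.N m → T.app (T.app c k) m = T.z → ∀ y, T.Seq D y →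
        (∀ i, T.N i → ∀ j, T.N j → T.app (T.app (T.app w k) i) j = T.z → T.app y i = T.app x j) →
        ¬ S m y)) ∧
    (∀ k, T.N k → T.app e k = T.z → ∀ x, T.Seq D x → (S k x ↔
      ∀ i, T.N i → ∀ j, T.N j → T.app (T.app (T.app w k) i) j = T.z → T.app x i = T.app x j)) ∧
    ∀ x, T.Seq D x → S n x

structure Str.Ax {M : Type} (T : Str M) : Prop where
  h1 : T.N T.z
  h2 : ∀ x, T.N x → T.N (T.s x)
  h3 : ∀ x, T.N x → ¬ T.s x = T.z
  h4 : ∀ x, T.N x → ∀ y, T.N y → T.s x = T.s y → x = y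
  h5 : ∀ R : M → M → Prop, R T.z T.z → (∀ x, T.N x → R x x → R (T.s x) (T.s x)) →
    ∀ x, T.N x → R x x
  h6 : ∀ R : M → M → Prop, (∀ x, T.N x → ∃ y, R x y) → ∃ m, ∀ x, T.N x → R x (T.app m x)
  h7 : ∀ m m', (∀ x, T.N x → T.app m x = T.app m' x) → m = m'
  h8 : ∀ m m', (∀ x, T.P x ∨ T.N x → (T.G x m ↔ T.G x m')) → m = m'
  h9 : ∀ Q : M → M → Prop, (∀ x, Q x x → T.P x) →
    (∀ x, Q x x → ∀ y, Q y y → x = y) ∨ InjP T.P (fun x => Q x x) ∨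
    ∃ c w q e n, T.N n ∧
      (∃ D : M → M → Prop, InjP (fun x => Q x x) (fun x => D x x) ∧
        T.Mod c w q e n (fun x => D x x)) ∧
      ¬ ∃ D : M → M → Prop, InjP T.P (fun x => D x x) ∧ T.Mod c w q e n (fun x => D x x)

def fInj (A B : L0.Term ℕ → Fml L0) : Fml L0 :=
  .qII 1 (fand (.all 7 (fimp (A (tv 7)) (fex 8 (fand (B (tv 8)) (.rmem 1 (tv 7) (tv 8))))))
    (.all 7 (fimp (A (tv 7)) (.all 8 (fimp (A (tv 8)) (.all 9 (fimp (.rmem 1 (tv 7) (tv 9))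
      (fimp (.rmem 1 (tv 8) (tv 9)) (.eq (tv 7) (tv 8))))))))))

def fSeq (x : ℕ) : Fml L0 := .all 6 (fimp (fN (tv 6)) (fR 2 (ta (tv x) (tv 6))))

def fW (a b : L0.Term ℕ) : Fml L0 :=
  .all 4 (fimp (fN (tv 4)) (.all 5 (fimp (fN (tv 5))
    (fimp (.eq (ta (ta (ta (tv 11) (tv 0)) (tv 4)) (tv 5)) tz) (.eq a b)))))

def fMod : Fml L0 := .qII 3 (fand
  (.all 0 (fimp (fN (tv 0)) (fimp (.eq (ta (tv 12) (tv 0)) tz) (.all 1 (fimp (fSeq 1)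
    (fiff (.rmem 3 (tv 0) (tv 1))
      (.all 2 (fimp (fN (tv 2)) (fimp (.eq (ta (ta (tv 10) (tv 0)) (tv 2)) tz)
        (.all 3 (fimp (fSeq 3) (fimp (fW (ta (tv 3) (tv 4)) (ta (tv 1) (tv 5)))
          (.not (.rmem 3 (tv 2) (tv 3)))))))))))))))
  (fand
  (.all 0 (fimp (fN (tv 0)) (fimp (.eq (ta (tv 13) (tv 0)) tz) (.all 1 (fimp (fSeq 1)
    (fiff (.rmem 3 (tv 0) (tv 1)) (fW (ta (tv 1) (tv 4)) (ta (tv 1) (tv 5)))))))))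
  (.all 1 (fimp (fSeq 1) (.rmem 3 (tv 14) (tv 1))))))

def chi0 : Fml L0 :=
  fand (fN tz) <|
  fand (.all 0 (fimp (fN (tv 0)) (fN (ts (tv 0))))) <|
  fand (.all 0 (fimp (fN (tv 0)) (.not (.eq (ts (tv 0)) tz)))) <|
  fand (.all 0 (fimp (fN (tv 0)) (.all 1 (fimp (fN (tv 1)) (fimp (.eq (ts (tv 0)) (ts (tv 1)))
    (.eq (tv 0) (tv 1))))))) <|
  fand (fallR 0 (fimp (.rmem 0 tz tz) (fimp (.all 0 (fimp (fN (tv 0)) (fimp (fR 0 (tv 0))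
    (fR 0 (ts (tv 0)))))) (.all 0 (fimp (fN (tv 0)) (fR 0 (tv 0))))))) <|
  fand (fallR 0 (fimp (.all 0 (fimp (fN (tv 0)) (fex 1 (.rmem 0 (tv 0) (tv 1)))))
    (fex 1 (.all 0 (fimp (fN (tv 0)) (.rmem 0 (tv 0) (ta (tv 1) (tv 0)))))))) <|
  fand (.all 0 (.all 1 (fimp (.all 2 (fimp (fN (tv 2)) (.eq (ta (tv 0) (tv 2)) (ta (tv 1) (tv 2)))))
    (.eq (tv 0) (tv 1))))) <|
  fand (.all 0 (.all 1 (fimp (.all 2 (fimp (fOr (fP (tv 2)) (fN (tv 2)))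
    (fiff (fG (tv 2) (tv 0)) (fG (tv 2) (tv 1))))) (.eq (tv 0) (tv 1))))) <|
  fallR 0 (fimp (.all 0 (fimp (fR 0 (tv 0)) (fP (tv 0))))
    (fOr (.all 0 (fimp (fR 0 (tv 0)) (.all 1 (fimp (fR 0 (tv 1)) (.eq (tv 0) (tv 1))))))
    (fOr (fInj fP (fR 0))
    (fex 10 (fex 11 (fex 12 (fex 13 (fex 14 (fand (fN (tv 14)) (fand
      (.qII 2 (fand (fInj (fR 0) (fR 2)) fMod))
      (.not (.qII 2 (fand (fInj fP (fR 2)) fMod))))))))))))) 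

section
variable {M : Type} [S : L0.Structure M] (va : ℕ → M) (vs : ℕ → Set M) (vr : ℕ → M → M → Prop)

theorem ev_inj1 : Eval (fInj fP (fR 0)) va vs vr ↔ InjP (toStr S).P (fun x => vr 0 x x) := by
  simp [fInj, InjP, eval_exR, eval_and, eval_all, eval_imp, eval_ex, ev_P, ev_R, re_v, eval_rmem,
    eval_eq, Function.update_apply]

theorem ev_inj2 : Eval (fInj fP (fR 2)) va vs vr ↔ InjP (toStr S).P (fun x => vr 2 x x) := by
  simp [fInj, InjP, eval_exR, eval_and, eval_all, eval_imp, eval_ex, ev_P, ev_R, re_v, eval_rmem,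
    eval_eq, Function.update_apply]

theorem ev_inj3 : Eval (fInj (fR 0) (fR 2)) va vs vr ↔
    InjP (fun x => vr 0 x x) (fun x => vr 2 x x) := by
  simp [fInj, InjP, eval_exR, eval_and, eval_all, eval_imp, eval_ex, ev_P, ev_R, re_v, eval_rmem,
    eval_eq, Function.update_apply]

theorem ev_seq1 : Eval (fSeq 1) va vs vr ↔ (toStr S).Seq (fun x => vr 2 x x) (va 1) := by
  simp [fSeq, Str.Seq, eval_all, eval_imp, ev_N, ev_R, re_v, re_a, Function.update_apply]

theorem ev_seq3 : Eval (fSeq 3) va vs vr ↔ (toStr S).Seq (fun x => vr 2 x x) (va 3) := by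
  simp [fSeq, Str.Seq, eval_all, eval_imp, ev_N, ev_R, re_v, re_a, Function.update_apply]

theorem ev_mod : Eval fMod va vs vr ↔
    (toStr S).Mod (va 10) (va 11) (va 12) (va 13) (va 14) (fun x => vr 2 x x) := by
  simp [fMod, fW, Str.Mod, eval_exR, eval_and, eval_all, eval_imp, eval_iff, ev_N, eval_eq, re_v,
    re_a, re_z, ev_seq1, ev_seq3, eval_rmem, eval_not, Function.update_apply]

theorem ev_chi0 : Eval chi0 va vs vr ↔ (toStr S).Ax := by
  simp only [chi0, eval_and, eval_all, eval_allR, eval_imp, eval_iff, eval_or, eval_not, eval_ex,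
    eval_exR, eval_eq, eval_rmem, ev_N, ev_P, ev_G, ev_R, re_v, re_z, re_s, re_a, ev_inj1,
    ev_inj2, ev_inj3, ev_mod, Function.update_apply]
  constructor
  · rintro ⟨h1, h2, h3, h4, h5, h6, h7, h8, h9⟩
    exact ⟨h1, h2, h3, h4, h5, h6, h7, h8, h9⟩
  · rintro ⟨h1, h2, h3, h4, h5, h6, h7, h8, h9⟩
    exact ⟨h1, h2, h3, h4, h5, h6, h7, h8, h9⟩

end

theorem bd_chi0 : Bd 15 chi0 := by
  unfold chi0 fMod fInj fSeq fW
  repeat' first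
    | with_reducible apply Bd.conj | with_reducible apply Bd.or | with_reducible apply Bd.imp | with_reducible apply Bd.iff | with_reducible apply Bd.ex | with_reducible apply Bd.allR
    | with_reducible apply Bd.P | with_reducible apply Bd.N | with_reducible apply Bd.G | with_reducible apply Bd.R | with_reducible apply Bd.not | with_reducible apply Bd.all
    | with_reducible apply Bd.exR | with_reducible apply Bd.eq | with_reducible apply Bd.rmem
    | with_reducible apply TB.z | with_reducible apply TB.s | with_reducible apply TB.a | with_reducible apply TB.var
  all_goals norm_num

def chi : Fml L0 := close chi0 15

theorem chi_ok : IsSentence chi ∧ Ok LII chi := close_sentence bd_chi0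

theorem chi_sat {M : Type} [Nonempty M] (S : L0.Structure M) : @Sat L0 M S chi ↔ (toStr S).Ax := by
  have := close_eval (a := chi0) (M := M) _ ev_chi0 15
  obtain ⟨m⟩ := ‹Nonempty M›
  constructor
  · intro h
    exact (this (fun _ => m) (fun _ => ∅) (fun _ _ _ => False)).1 (h _ _ _)
  · intro h va vs vr
    exact (this va vs vr).2 h

/-! ### Analysis of the models -/

theorem injP_iff {M : Type} (A B : M → Prop) : InjP A B ↔ #{a // A a} ≤ #{b // B b} := by
  constructor
  · rintro ⟨f, h1, h2⟩
    choose g hg using h1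
    refine Cardinal.mk_le_of_injective (f := fun a : {a // A a} =>
      (⟨g a.1 a.2, (hg a.1 a.2).1⟩ : {b // B b})) ?_
    intro a a' h
    have h' : g a.1 a.2 = g a'.1 a'.2 := congrArg Subtype.val h
    refine Subtype.ext (h2 _ a.2 _ a'.2 _ (hg a.1 a.2).2 ?_)
    rw [h']
    exact (hg a'.1 a'.2).2
  · intro h
    rw [Cardinal.le_def] at h
    obtain ⟨f⟩ := h
    refine ⟨fun a b => ∃ h : A a, b = (f ⟨a, h⟩).1, ?_, ?_⟩
    · intro a ha
      exact ⟨_, (f ⟨a, ha⟩).2, ha, rfl⟩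
    · rintro a ha a' ha' b ⟨h, rfl⟩ ⟨h', e⟩
      have := f.injective (Subtype.ext e)
      exact congrArg Subtype.val this

structure Str.Arith {M : Type} (T : Str M) (ν : ℕ → M) : Prop where
  inj : Function.Injective ν
  N : ∀ x, T.N x ↔ ∃ k, ν k = x
  z : ν 0 = T.z
  bij : Function.Bijective (fun m k => T.app m (ν k))

theorem Str.Ax.nat {M : Type} {T : Str M} (h : T.Ax) : ∃ ν, T.Arith ν := by
  let ν : ℕ → M := fun k => Nat.rec T.z (fun _ a => T.s a) k
  have hs : ∀ k, ν (k + 1) = T.s (ν k) := fun k => rfl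
  have hN : ∀ k, T.N (ν k) := by
    intro k
    induction k with
    | zero => exact h.h1
    | succ k ih => exact h.h2 _ ih
  have hi : ∀ k l, ν k = ν l → k = l := by
    intro k
    induction k with
    | zero =>
      intro l hl
      cases l with
      | zero => rfl
      | succ l => exact absurd hl.symm (h.h3 _ (hN l))
    | succ k ih =>
      intro l hl
      cases l with
      | zero => exact absurd hl (h.h3 _ (hN k))
      | succ l => rw [ih l (h.h4 _ (hN k) _ (hN l) hl)]
  refine ⟨ν, fun k l => hi k l, ?_, rfl, ?_, ?_⟩
  · intro x
    constructor
    · intro hx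
      refine h.h5 (fun x _ => ∃ k, ν k = x) ⟨0, rfl⟩ ?_ x hx
      rintro _ _ ⟨k, rfl⟩
      exact ⟨k + 1, rfl⟩
    · rintro ⟨k, rfl⟩
      exact hN k
  · intro m m' hm
    refine h.h7 m m' fun x hx => ?_
    have : ∃ k, ν k = x := by
      refine h.h5 (fun x _ => ∃ k, ν k = x) ⟨0, rfl⟩ ?_ x hx
      rintro _ _ ⟨k, rfl⟩
      exact ⟨k + 1, rfl⟩
    obtain ⟨k, rfl⟩ := this
    exact congrFun hm k
  · intro f
    have hex : ∀ x, T.N x → ∃ y, ∀ k, ν k = x → y = f k := by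
      intro x hx
      have : ∃ k, ν k = x := by
        refine h.h5 (fun x _ => ∃ k, ν k = x) ⟨0, rfl⟩ ?_ x hx
        rintro _ _ ⟨k, rfl⟩
        exact ⟨k + 1, rfl⟩
      obtain ⟨k, rfl⟩ := this
      refine ⟨f k, fun l hl => ?_⟩
      rw [hi _ _ hl]
    obtain ⟨m, hm⟩ := h.h6 (fun x y => ∀ k, ν k = x → y = f k) hex
    refine ⟨m, funext fun k => ?_⟩
    exact hm (ν k) (hN k) k rfl

/-- The data decoded from elements. -/
def Str.dec {M : Type} (T : Str M) (ν : ℕ → M) (c w q e : M) : Data0 where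
  isQ k := T.app q (ν k) = T.z
  isE k := T.app e (ν k) = T.z
  C k m := T.app (T.app c (ν k)) (ν m) = T.z
  w k i j := T.app (T.app (T.app w (ν k)) (ν i)) (ν j) = T.z

theorem Str.Arith.exists_dec {M : Type} {T : Str M} {ν : ℕ → M} (h : T.Arith ν) (d : Data0) :
    ∃ c w q e, T.dec ν c w q e = d := by
  have hne : ν 1 ≠ T.z := by
    rw [← h.z]
    intro h'
    exact absurd (h.inj h') one_ne_zero
  have e1 : ∀ p : ℕ → Prop, ∃ m, ∀ k, T.app m (ν k) = T.z ↔ p k := by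
    intro p
    classical
    obtain ⟨m, hm⟩ := h.bij.2 (fun k => if p k then T.z else ν 1)
    refine ⟨m, fun k => ?_⟩
    have := congrFun hm k
    simp only at this
    rw [this]
    by_cases hp : p k <;> simp [hp, hne]
  have e2 : ∀ f : ℕ → M, ∃ m, ∀ k, T.app m (ν k) = f k := by
    intro f
    obtain ⟨m, hm⟩ := h.bij.2 f
    exact ⟨m, fun k => congrFun hm k⟩
  obtain ⟨q, hq⟩ := e1 d.isQ
  obtain ⟨e, he⟩ := e1 d.isE
  choose c' hc' using fun k => e1 (d.C k)
  obtain ⟨c, hc⟩ := e2 c'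
  choose w'' hw'' using fun k i => e1 (d.w k i)
  choose w' hw' using fun k => e2 (w'' k)
  obtain ⟨w, hw⟩ := e2 w'
  refine ⟨c, w, q, e, ?_⟩
  cases d
  simp only [Str.dec, Data0.mk.injEq]
  refine ⟨?_, ?_, ?_, ?_⟩
  · funext k; exact propext (hq k)
  · funext k; exact propext (he k)
  · funext k m; rw [hc]; exact propext (hc' k m)
  · funext k i j; rw [hw, hw']; exact propext (hw'' k i j)

theorem Str.Arith.mod_iff {M : Type} {T : Str M} {ν : ℕ → M} (h : T.Arith ν) (c w q e : M) (n : ℕ)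
    (D : M → Prop) : T.Mod c w q e (ν n) D ↔ (T.dec ν c w q e).Has n {a // D a} := by
  have hseq : ∀ x, T.Seq D x ↔ ∀ i, D (T.app x (ν i)) := by
    intro x
    simp only [Str.Seq, h.N, forall_exists_index, forall_apply_eq_imp_iff]
  have e2 : ∀ f : ℕ → M, ∃ m, ∀ k, T.app m (ν k) = f k := by
    intro f
    obtain ⟨m, hm⟩ := h.bij.2 f
    exact ⟨m, fun k => congrFun hm k⟩
  choose E hE using e2
  simp only [Str.Mod, h.N, forall_exists_index, forall_apply_eq_imp_iff, hseq]
  constructor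
  · rintro ⟨S, h1, h2, h3⟩
    refine ⟨fun k x => S (ν k) (E fun i => (x i).1), ⟨?_, ?_⟩, ?_⟩
    · intro k hk x
      rw [h1 k hk (E fun i => (x i).1) (fun i => by rw [hE]; exact (x i).2)]
      constructor
      · intro H m hm y hy
        refine H m hm _ (fun i => by rw [hE]; exact (y i).2) ?_
        intro i j hij
        rw [hE, hE]
        exact congrArg Subtype.val (hy i j hij)
      · intro H m hm y hyD hy
        have := H m hm (fun i => ⟨T.app y (ν i), hyD i⟩) ?_
        · have h' : E (fun i => T.app y (ν i)) = y := by
            apply h.bij.1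
            funext k
            exact hE _ _
          simp only [h'] at this
          exact this
        · intro i j hij
          refine Subtype.ext ?_
          have := hy i j hij
          rw [hE] at this
          exact this
    · intro k hk x
      rw [h2 k hk (E fun i => (x i).1) (fun i => by rw [hE]; exact (x i).2)]
      simp only [hE, Subtype.ext_iff]
      rfl
    · intro x
      exact h3 _ (fun i => by rw [hE]; exact (x i).2)
  · rintro ⟨S, hS, hn⟩
    let S' : M → M → Prop := fun a x => ∃ k x', ν k = a ∧ (∀ i, T.app x (ν i) = (x' i).1) ∧ S k x'
    have hS' : ∀ k x (hx : ∀ i, D (T.app x (ν i))),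
        S' (ν k) x ↔ S k (fun i => ⟨T.app x (ν i), hx i⟩) := by
      intro k x hx
      constructor
      · rintro ⟨l, x', hl, hx', hh⟩
        rw [← h.inj hl]
        convert hh using 3
        exact hx' _
      · intro hh
        exact ⟨k, _, rfl, fun i => rfl, hh⟩
    refine ⟨S', ?_, ?_, ?_⟩
    · intro k hk x hx
      rw [hS' k x hx, hS.hq k hk]
      constructor
      · intro H m hm y hyD hy
        rw [hS' m y hyD]
        exact H m hm _ fun i j hij => Subtype.ext (hy i j hij)
      · intro H m hm y hy
        have hyD : ∀ i, D (T.app (E fun i => (y i).1) (ν i)) := by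
          intro i
          rw [hE]
          exact (y i).2
        have := H m hm (E fun i => (y i).1) hyD ?_
        · rw [hS' m _ hyD] at this
          simpa only [hE] using this
        · intro i j hij
          rw [hE]
          exact congrArg Subtype.val (hy i j hij)
    · intro k hk x hx
      rw [hS' k x hx, hS.he k hk]
      simp only [Subtype.ext_iff]
      rfl
    · intro x hx
      rw [hS' n x hx]
      exact hn _

theorem has_le {d : Data0} {n : ℕ} {B M : Type} (h : d.Has n B) (hle : #B ≤ #M) :
    ∃ D : M → Prop, #{a // D a} = #B ∧ d.Has n {a // D a} := by
  rw [Cardinal.le_def] at hle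
  obtain ⟨f⟩ := hle
  let e : B ≃ {a // a ∈ Set.range f} := Equiv.ofInjective f f.injective
  exact ⟨fun a => a ∈ Set.range f, (Cardinal.mk_congr e).symm, h.congr e⟩

/-! ### Boundedness of the sentence -/

noncomputable def bnd (p : Data0 × ℕ) : Cardinal.{0} :=
  sSup {c | ∃ D : Type, p.1.Has p.2 D ∧ c = Order.succ #D}

noncomputable def kap : Cardinal.{0} := max (⨆ p, bnd p) 2

theorem Str.Ax.card_P {M : Type} {T : Str M} (h : T.Ax) : #{a // T.P a} ≤ kap := by
  obtain ⟨ν, hν⟩ := h.nat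
  by_contra hcon
  rw [not_le] at hcon
  obtain ⟨Q, hQ⟩ := Cardinal.le_mk_iff_exists_set.1 hcon.le
  let R : M → M → Prop := fun x _ => ∃ hx : T.P x, (⟨x, hx⟩ : {a // T.P a}) ∈ Q
  have hR : #{x // R x x} = kap := by
    rw [← hQ]
    refine Cardinal.mk_congr ?_
    exact
      { toFun := fun x => ⟨⟨x.1, x.2.1⟩, x.2.2⟩
        invFun := fun x => ⟨x.1.1, x.1.2, x.2⟩
        left_inv := fun x => rfl
        right_inv := fun x => rfl }
  have h2 : (2 : Cardinal) ≤ kap := le_max_right _ _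
  rcases h.h9 R (fun x hx => hx.1) with hs | hs | ⟨c, w, q, e, n, hn, ⟨D, hD1, hD2⟩, hno⟩
  · have : #{x // R x x} ≤ 1 := by
      rw [Cardinal.le_one_iff_subsingleton]
      exact ⟨fun x y => Subtype.ext (hs _ x.2 _ y.2)⟩
    rw [hR] at this
    exact absurd (h2.trans this) (not_le.2 Cardinal.one_lt_two)
  · rw [injP_iff, hR] at hs
    exact absurd hcon (not_lt.2 hs)
  · rw [hν.N] at hn
    obtain ⟨n, rfl⟩ := hn
    rw [hν.mod_iff] at hD2
    rw [injP_iff, hR] at hD1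
    set d := T.dec ν c w q e with hd
    by_cases hb : BddAbove {c | ∃ D : Type, d.Has n D ∧ c = Order.succ #D}
    · have h1 : Order.succ #{a // D a a} ≤ bnd (d, n) := le_csSup hb ⟨_, hD2, rfl⟩
      have h3 : bnd (d, n) ≤ kap :=
        (le_ciSup (Cardinal.bddAbove_of_small) (d, n)).trans (le_max_left _ _)
      have h4 := (h1.trans h3).trans hD1
      exact absurd (Order.lt_succ #{a // D a a}) (not_lt.2 h4)
    · rw [not_bddAbove_iff] at hb
      obtain ⟨_, ⟨D', hD', rfl⟩, hlt⟩ := hb (Order.succ #M)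
      have hlt' : #M ≤ #D' := (Order.succ_lt_succ_iff.1 hlt).le
      have hP : #{a // T.P a} ≤ #M := Cardinal.mk_subtype_le _
      have hal : ℵ₀ ≤ #M := by
        rw [← Cardinal.mk_nat]
        exact Cardinal.mk_le_of_injective hν.inj
      have hpow : #M ^ ℵ₀ ≤ #M := by
        have := Cardinal.mk_congr (Equiv.ofBijective _ hν.bij)
        rw [Cardinal.mk_arrow] at this
        simp only [Cardinal.lift_id, Cardinal.mk_nat] at this
        exact this.ge
      obtain ⟨B, hB1, hB2, hB3⟩ := hD'.skolem (hP.trans hlt') hP hal hpow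
      obtain ⟨E, hE1, hE2⟩ := has_le hB3 hB2
      refine hno ⟨fun x _ => E x, ?_, ?_⟩
      · rw [injP_iff, hE1]
        exact hB1
      · rw [hν.mod_iff]
        exact hE2

theorem chi_bdd : BddSpec chi := by
  refine ⟨Order.succ (2 ^ (kap + ℵ₀)), fun M S hM => ?_⟩
  rw [Order.lt_succ_iff]
  rcases isEmpty_or_nonempty M with hE | hE
  · simp
  rw [chi_sat] at hM
  have hP := hM.card_P
  obtain ⟨ν, hν⟩ := hM.nat
  set T := toStr S with hT
  let U : Set M := {a | T.P a} ∪ {a | T.N a}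
  have hU : #U ≤ kap + ℵ₀ := by
    refine (Cardinal.mk_union_le _ _).trans (add_le_add hP ?_)
    have : {a | T.N a} = Set.range ν := by
      ext a
      exact hν.N a
    rw [this, ← Cardinal.mk_nat]
    exact Cardinal.mk_range_le
  have h1 : #M ≤ #(Set U) := by
    refine Cardinal.mk_le_of_injective (f := fun m => {x : U | T.G x.1 m}) ?_
    intro m m' hmm
    refine hM.h8 m m' fun x hx => ?_
    have := Set.ext_iff.1 hmm ⟨x, hx⟩
    exact this
  rw [Cardinal.mk_set] at h1
  exact h1.trans (Cardinal.power_le_power_left two_ne_zero hU)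

/-! ### A large model -/

theorem small_c : BddAbove {c | ∃ (L : FirstOrder.Language.{0,0}) (φ : Fml L),
      IsSentence φ ∧ Ok Lc φ ∧ BddSpec φ ∧ c = hanfVal φ} :=
  small Lc (by simp [Lc]) (by simp [Lc]) (by simp [Lc]) rfl

theorem small_II : BddAbove {c | ∃ (L : FirstOrder.Language.{0,0}) (φ : Fml L),
      IsSentence φ ∧ Ok LII φ ∧ BddSpec φ ∧ c = hanfVal φ} :=
  small LII (by simp [LII]) (by simp [LII]) (by simp [LII]) rfl

theorem exists_model : ∃ (M : Type) (T : Str M), T.Ax ∧ hanfNum Lc ≤ #M ∧ Nonempty M := by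
  let K : Type := (hanfNum Lc).out
  have hK : #K = hanfNum Lc := Cardinal.mk_out _
  let X : Type := K ⊕ ℕ
  have hX : ℵ₀ ≤ #X := Cardinal.aleph0_le_mk X
  let M : Type := Set X
  have hKM : hanfNum Lc ≤ #M := by
    rw [← hK]
    refine Cardinal.mk_le_of_injective (f := fun k : K => ({Sum.inl k} : Set X)) ?_
    intro a b hab
    exact Sum.inl_injective (Set.singleton_injective hab)
  have hF : #M = #(ℕ → M) := by
    simp only [M, Cardinal.mk_set, Cardinal.mk_arrow, Cardinal.lift_id, Cardinal.mk_nat]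
    rw [← Cardinal.power_mul, Cardinal.mul_aleph0_eq hX]
  obtain ⟨F⟩ := Cardinal.eq.1 hF
  let ν : ℕ → M := fun k => {Sum.inr k}
  have hν : Function.Injective ν := by
    intro a b hab
    exact Sum.inr_injective (Set.singleton_injective hab)
  have hinv : ∀ k, Function.invFun ν (ν k) = k := Function.leftInverse_invFun hν
  let T : Str M :=
    { z := ν 0
      s := fun a => ν (Function.invFun ν a + 1)
      app := fun m a => F m (Function.invFun ν a)
      P := fun a => ∃ k, a = ({Sum.inl k} : Set X)
      N := fun a => ∃ k, ν k = a
      G := fun x m => (x : Set X) ⊆ m }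
  have happ : ∀ m k, T.app m (ν k) = F m k := by
    intro m k
    simp only [T, hinv]
  have hs : ∀ k, T.s (ν k) = ν (k + 1) := by
    intro k
    simp only [T, hinv]
  have hT : T.Arith ν := by
    refine ⟨hν, fun x => Iff.rfl, rfl, ?_⟩
    simp only [happ]
    exact F.bijective
  have hP : #{a // T.P a} = hanfNum Lc := by
    rw [← hK]
    refine (Cardinal.mk_congr (Equiv.ofBijective
      (fun k : K => (⟨{Sum.inl k}, k, rfl⟩ : {a // T.P a})) ⟨?_, ?_⟩)).symm
    · intro a b hab
      exact Sum.inl_injective (Set.singleton_injective (congrArg Subtype.val hab))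
    · rintro ⟨_, k, rfl⟩
      exact ⟨k, rfl⟩
  refine ⟨M, T, ⟨⟨0, rfl⟩, ?_, ?_, ?_, ?_, ?_, ?_, ?_, ?_⟩, hKM, ⟨ν 0⟩⟩
  · rintro _ ⟨k, rfl⟩
    exact ⟨k + 1, (hs k).symm⟩
  · rintro _ ⟨k, rfl⟩ h
    rw [hs] at h
    exact absurd (hν h) (Nat.succ_ne_zero k)
  · rintro _ ⟨k, rfl⟩ _ ⟨l, rfl⟩ h
    rw [hs, hs] at h
    have := hν h
    simp only [Nat.add_right_cancel_iff] at this
    rw [this]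
  · rintro R h0 h1 _ ⟨k, rfl⟩
    induction k with
    | zero => exact h0
    | succ k ih =>
      have := h1 (ν k) ⟨k, rfl⟩ ih
      rwa [hs] at this
  · intro R hR
    choose f hf using fun k => hR (ν k) ⟨k, rfl⟩
    refine ⟨F.symm f, ?_⟩
    rintro _ ⟨k, rfl⟩
    rw [happ]
    simpa using hf k
  · intro m m' h
    apply F.injective
    funext k
    have := h (ν k) ⟨k, rfl⟩
    rwa [happ, happ] at this
  · intro m m' h
    refine Set.ext fun x => ?_
    cases x with
    | inl k =>
      have := h {Sum.inl k} (Or.inl ⟨k, rfl⟩)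
      exact Set.singleton_subset_iff.symm.trans (this.trans Set.singleton_subset_iff)
    | inr k =>
      have := h (ν k) (Or.inr ⟨k, rfl⟩)
      exact Set.singleton_subset_iff.symm.trans (this.trans Set.singleton_subset_iff)
  · intro Q hQ
    by_cases hsub : ∀ x, Q x x → ∀ y, Q y y → x = y
    · exact Or.inl hsub
    refine Or.inr ?_
    by_cases hinj : InjP T.P (fun x => Q x x)
    · exact Or.inl hinj
    refine Or.inr ?_
    rw [injP_iff, not_le, hP] at hinj
    obtain ⟨_, ⟨L, φ, h1, h2, h3, rfl⟩, hlt⟩ := exists_lt_of_lt_csSup' hinj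
    obtain ⟨_, ⟨D, S, hD, rfl⟩, hlt'⟩ := exists_lt_of_lt_csSup' hlt
    have hle : #{x // Q x x} ≤ #D := Order.lt_succ_iff.1 hlt'
    have hnt : Nontrivial {x // Q x x} := by
      push Not at hsub
      obtain ⟨x, hx, y, hy, hxy⟩ := hsub
      exact ⟨⟨x, hx⟩, ⟨y, hy⟩, fun h => hxy (congrArg Subtype.val h)⟩
    have hbig : ∀ D : Type, #{x // Q x x} ≤ #D → Nontrivial D := by
      intro D hle
      rw [← Cardinal.one_lt_iff_nontrivial] at hnt ⊢
      exact hnt.trans_le hle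
    have hub : ∀ (D : Type) (S : L.Structure D), @Sat L D S φ → #D < hanfNum Lc := by
      intro D S hD
      have a1 : Order.succ #D ≤ hanfVal φ := le_csSup (hanfVal_bdd φ h3) ⟨D, S, hD, rfl⟩
      have a2 : hanfVal φ ≤ hanfNum Lc := le_csSup small_c ⟨L, φ, h1, h2, h3, rfl⟩
      exact Order.succ_le_iff.1 (a1.trans a2)
    obtain ⟨d, n, hd⟩ := sentence_data0 φ h1 h2
    obtain ⟨c, w, q, e, hdec⟩ := hT.exists_dec d
    refine ⟨c, w, q, e, ν n, ⟨n, rfl⟩, ?_, ?_⟩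
    · have := hbig D hle
      obtain ⟨E, hE1, hE2⟩ := has_le (M := M) ((hd D).1 ⟨S, hD⟩) ((hub D S hD).le.trans hKM)
      refine ⟨fun x _ => E x, ?_, ?_⟩
      · rw [injP_iff, hE1]
        exact hle
      · rw [hT.mod_iff, hdec]
        exact hE2
    · rintro ⟨E, hE1, hE2⟩
      rw [injP_iff, hP] at hE1
      rw [hT.mod_iff, hdec] at hE2
      have := hbig _ (hinj.le.trans hE1)
      obtain ⟨S', hS'⟩ := (hd _).2 hE2
      exact absurd (hub _ S' hS') (not_lt.2 hE1)


/-- The Hanf number of the countable-set-quantifier logic is strictly less than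
that of second-order logic: `h(L^c_{ω,ω}) < h(L^{II}_{ω,ω})`. -/
theorem hanf_c_lt_hanf_II : hanfNum Lc < hanfNum LII := by
  obtain ⟨M, T, hT, hM, hne⟩ := exists_model
  have h1 : @Sat L0 M (ofStr T) chi := (chi_sat (ofStr T)).2 hT
  have h2 : Order.succ #M ≤ hanfVal chi :=
    le_csSup (hanfVal_bdd chi chi_bdd) ⟨M, ofStr T, h1, rfl⟩
  have h3 : hanfVal chi ≤ hanfNum LII :=
    le_csSup small_II ⟨L0, chi, chi_ok.1, chi_ok.2, chi_bdd, rfl⟩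
  exact hM.trans_lt (Order.succ_le_iff.1 (h2.trans h3))

end Hanf
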